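/- arXiv:1303.2825 — 3 statements merged into one kernel-verified Lean document; each statement's English description precedes it below -/
import Mathlib

section
/- (Favard's theorem) Let (p_n)_{n≥0} be a sequence of real polynomials with deg p_n = n, satisfying x·p_0(x) = a_0 p_1(x) + b_0 p_0(x) and x·p_n(x) = a_n p_{n+1}(x) + b_n p_n(x) + c_n p_{n-1}(x) for n ≥ 1, where a_n, b_n, c_n are real constants with a_n c_{n+1} > 0 for all n ≥ 0. Then there exists a positive Borel measure μ on ℝ with all moments finite such that ∫ p_m(x) p_n(x) dμ(x) = 0 for all m ≠ n and ∫ p_n(x)^2 dμ(x) > 0 for all n. -/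
open MeasureTheory Polynomial Filter Topology CompactlySupported

namespace Polynomial

/-- A real polynomial that is nonnegative on the line is a sum of two squares. -/
theorem exists_eq_sq_add_sq_of_eval_nonneg (q : ℝ[X]) (hq : ∀ x, 0 ≤ q.eval x) :
    ∃ r s : ℝ[X], q = r ^ 2 + s ^ 2 := by
  induction hn : q.natDegree using Nat.strong_induction_on generalizing q with
  | _ n ih =>
  subst hn
  by_cases h0 : q.natDegree = 0
  · obtain ⟨t, rfl⟩ := natDegree_eq_zero.mp h0
    have ht : 0 ≤ t := by simpa using hq 0
    exact ⟨C (√t), 0, by rw [← C_pow, Real.sq_sqrt ht]; simp⟩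
  have hq0 : q ≠ 0 := by rintro rfl; simp at h0
  obtain ⟨z, hz⟩ := Complex.exists_root (f := q.map (algebraMap ℝ ℂ)) (by
    rw [degree_map]; exact natDegree_pos_iff_degree_pos.mp (Nat.pos_of_ne_zero h0))
  have hz' : aeval z q = 0 := by simpa [aeval_def, eval_map] using hz
  by_cases him : z.im = 0
  · obtain ⟨t, rfl⟩ : ∃ t : ℝ, z = t := ⟨z.re, Complex.ext rfl (by simpa using him)⟩
    have ht : q.IsRoot t := by
      have h := aeval_algebraMap_apply ℂ t q
      simp only [Complex.coe_algebraMap, coe_aeval_eq_eval] at h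
      rw [hz'] at h
      exact_mod_cast h.symm
    obtain ⟨s, hs⟩ := dvd_iff_isRoot.mpr ht
    have hpos : ∀ x, t < x → 0 ≤ s.eval x := fun x hx => by
      have := hq x
      rw [hs] at this
      simp only [eval_mul, eval_sub, eval_X, eval_C] at this
      exact nonneg_of_mul_nonneg_right this (sub_pos.mpr hx)
    have hneg : ∀ x, x < t → s.eval x ≤ 0 := fun x hx => by
      have := hq x
      rw [hs] at this
      simp only [eval_mul, eval_sub, eval_X, eval_C] at this
      nlinarith
    have hst : s.IsRoot t := by
      refine le_antisymm ?_ ?_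
      · exact le_of_tendsto (s.continuous.continuousAt.tendsto.mono_left nhdsWithin_le_nhds)
          (eventually_nhdsWithin_of_forall (s := Set.Iio t) hneg)
      · exact ge_of_tendsto (s.continuous.continuousAt.tendsto.mono_left nhdsWithin_le_nhds)
          (eventually_nhdsWithin_of_forall (s := Set.Ioi t) hpos)
    obtain ⟨r, rfl⟩ := dvd_iff_isRoot.mpr hst
    have hr0 : r ≠ 0 := by rintro rfl; simp at hs; exact hq0 hs
    have hr : ∀ x, x ≠ t → 0 ≤ r.eval x := fun x hx => by
      have := hq x
      rw [hs] at this
      simp only [eval_mul, eval_sub, eval_X, eval_C, ← mul_assoc] at this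
      exact nonneg_of_mul_nonneg_right this (mul_self_pos.mpr (sub_ne_zero.mpr hx))
    have hrt : ∀ x, 0 ≤ r.eval x := fun x => by
      rcases eq_or_ne x t with rfl | hx
      · exact ge_of_tendsto (r.continuous.continuousAt.tendsto.mono_left nhdsWithin_le_nhds)
          (eventually_nhdsWithin_of_forall (s := {x}ᶜ) hr)
      · exact hr x hx
    have hdeg : r.natDegree < q.natDegree := by
      rw [hs, natDegree_mul (X_sub_C_ne_zero t) (mul_ne_zero (X_sub_C_ne_zero t) hr0),
        natDegree_mul (X_sub_C_ne_zero t) hr0, natDegree_X_sub_C]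
      lia
    obtain ⟨u, v, huv⟩ := ih _ hdeg r hrt rfl
    exact ⟨(X - C t) * u, (X - C t) * v, by rw [hs, huv]; ring⟩
  · obtain ⟨r, hr⟩ := q.quadratic_dvd_of_aeval_eq_zero_im_ne_zero hz' him
    have hfac : X ^ 2 - C (2 * z.re) * X + C (‖z‖ ^ 2) = (X - C z.re) ^ 2 + C z.im ^ 2 := by
      rw [Complex.sq_norm, Complex.normSq_apply]
      simp only [map_add, map_mul, C_ofNat]
      ring
    have hpos : ∀ x, 0 ≤ r.eval x := fun x => by
      have := hq x
      rw [hr, hfac] at this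
      simp only [eval_mul, eval_add, eval_pow, eval_sub, eval_X, eval_C] at this
      exact nonneg_of_mul_nonneg_right this (by positivity)
    have hr0 : r ≠ 0 := by rintro rfl; simp at hr; exact hq0 hr
    have hd : (X ^ 2 - C (2 * z.re) * X + C (‖z‖ ^ 2)).natDegree = 2 := by compute_degree!
    have hdeg : r.natDegree < q.natDegree := by
      rw [hr, natDegree_mul (fun h => by rw [h, natDegree_zero] at hd; lia) hr0, hd]
      lia
    obtain ⟨u, v, huv⟩ := ih _ hdeg r hpos rfl
    exact ⟨(X - C z.re) * u - C z.im * v, (X - C z.re) * v + C z.im * u, by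
      rw [hr, huv, hfac]; ring⟩

end Polynomial

/-- A linear functional on polynomials that is nonnegative on nonnegative polynomials extends
to a linear functional on sums of polynomials and compactly supported continuous functions which
is nonnegative on nonnegative functions. -/
theorem exists_linearMap_polynomial_prod_of_nonneg (L : ℝ[X] →ₗ[ℝ] ℝ)
    (hL : ∀ q : ℝ[X], (∀ x, 0 ≤ q.eval x) → 0 ≤ L q) :
    ∃ g : ℝ[X] × C_c(ℝ, ℝ) →ₗ[ℝ] ℝ, (∀ q, g (q, 0) = L q) ∧
      ∀ q f, (∀ x, 0 ≤ q.eval x + f x) → 0 ≤ g (q, f) := by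
  let K : PointedCone ℝ (ℝ[X] × C_c(ℝ, ℝ)) :=
    { carrier := {y | ∀ x, 0 ≤ y.1.eval x + y.2 x}
      add_mem' := fun {y z} hy hz x => by
        have := add_nonneg (hy x) (hz x)
        simp only [Prod.fst_add, Prod.snd_add, eval_add, CompactlySupportedContinuousMap.add_apply]
        linarith
      zero_mem' := fun x => by simp
      smul_mem' := fun k y hy x => by
        have := mul_nonneg k.2 (hy x)
        rwa [mul_add, ← smul_eq_mul, ← smul_eq_mul, ← eval_smul] at this }
  let D : Submodule ℝ (ℝ[X] × C_c(ℝ, ℝ)) := LinearMap.range (LinearMap.inl ℝ _ _)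
  obtain ⟨g, hg, hgK⟩ := riesz_extension K ⟨D, (L ∘ₗ LinearMap.fst ℝ _ _) ∘ₗ D.subtype⟩
    (by
      rintro ⟨_, q, rfl⟩ hy
      exact hL q fun x => by simpa using hy x)
    (by
      rintro ⟨q, f⟩
      obtain ⟨M, hM⟩ := f.hasCompactSupport.exists_bound_of_continuous f.continuous
      refine ⟨⟨(-q + C M, 0), ⟨_, rfl⟩⟩, fun x => ?_⟩
      have := (abs_le.mp (hM x)).1
      simp
      linarith)
  exact ⟨g, fun q => hg ⟨(q, 0), ⟨q, rfl⟩⟩, fun q f h => hgK _ h⟩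

/-- The piecewise linear function equal to `1` on `[-R, R]` and to `0` off `[-(R + 1), R + 1]`. -/
noncomputable def tent (R x : ℝ) : ℝ := max 0 (min 1 (R + 1 - |x|))

theorem tent_nonneg (R x : ℝ) : 0 ≤ tent R x := le_max_left _ _

theorem tent_le_one (R x : ℝ) : tent R x ≤ 1 := max_le zero_le_one (min_le_left _ _)

theorem tent_eq_one {R x : ℝ} (h : |x| ≤ R) : tent R x = 1 := by
  rw [tent, min_eq_left (by linarith), max_eq_right zero_le_one]

theorem one_sub_tent_le {R : ℝ} (hR : 0 < R) (x : ℝ) : 1 - tent R x ≤ x ^ 2 / R ^ 2 := by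
  rcases le_or_gt |x| R with h | h
  · rw [tent_eq_one h, sub_self]; positivity
  · have : 1 ≤ x ^ 2 / R ^ 2 := by
      rw [le_div_iff₀ (by positivity), one_mul, ← sq_abs x]
      gcongr
    linarith [tent_nonneg R x]

theorem continuous_tent (R : ℝ) : Continuous (tent R) := by unfold tent; fun_prop

theorem hasCompactSupport_tent (R : ℝ) : HasCompactSupport (tent R) :=
  HasCompactSupport.intro (isCompact_Icc (a := -(R + 1)) (b := R + 1)) fun x hx => by
    have : R + 1 < |x| := by
      by_contra! h
      exact hx (abs_le.mp h)
    exact max_eq_left ((min_le_right _ _).trans (by linarith))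

/-- The product of a polynomial with the cutoff function `tent R`. -/
noncomputable def Polynomial.mulTent (q : ℝ[X]) (R : ℝ) : C_c(ℝ, ℝ) :=
  ⟨⟨fun x => q.eval x * tent R x, q.continuous.mul (continuous_tent R)⟩,
    (hasCompactSupport_tent R).mul_left⟩

theorem Polynomial.mulTent_apply (q : ℝ[X]) (R x : ℝ) :
    q.mulTent R x = q.eval x * tent R x := rfl

/-- **Hamburger's theorem**: a linear functional on real polynomials that is nonnegative on squares
is integration against a measure. -/
theorem exists_measure_integral_eval_eq (L : ℝ[X] →ₗ[ℝ] ℝ) (hL : ∀ q : ℝ[X], 0 ≤ L (q ^ 2)) :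
    ∃ μ : Measure ℝ, ∀ q : ℝ[X],
      Integrable (fun x => q.eval x) μ ∧ ∫ x, q.eval x ∂μ = L q := by
  obtain ⟨g, hgL, hg⟩ := exists_linearMap_polynomial_prod_of_nonneg L fun q hq => by
    obtain ⟨r, s, rfl⟩ := q.exists_eq_sq_add_sq_of_eval_nonneg hq
    rw [map_add]
    exact add_nonneg (hL r) (hL s)
  have hsub : ∀ q f, g (q, f) = L q + g (0, f) := fun q f => by
    rw [← hgL, ← map_add]; simp
  let Λ : C_c(ℝ, ℝ) →ₚ[ℝ] ℝ := PositiveLinearMap.mk₀ (g ∘ₗ LinearMap.inr ℝ _ _)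
    fun f hf => hg 0 f fun x => by simpa using hf x
  have hΛ : ∀ f, Λ f = g (0, f) := fun f => rfl
  have hle : ∀ (f : C_c(ℝ, ℝ)) (q : ℝ[X]), (∀ x, f x ≤ q.eval x) → Λ f ≤ L q := fun f q h => by
    have := hg q (-f) fun x => by simpa using h x
    rw [hsub, show ((0 : ℝ[X]), -f) = -(0, f) by simp, map_neg] at this
    rw [hΛ]
    linarith
  have hge : ∀ (f : C_c(ℝ, ℝ)) (q : ℝ[X]), (∀ x, q.eval x ≤ f x) → L q ≤ Λ f := fun f q h => by
    have := hg (-q) f fun x => by have := h x; simp; linarith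
    rw [hsub, map_neg] at this
    rw [hΛ]
    linarith
  let μ := RealRMK.rieszMeasure Λ
  have hμ : ∀ (q : ℝ[X]) (R : ℝ), ∫ x, q.eval x * tent R x ∂μ = Λ (q.mulTent R) := fun q R =>
    RealRMK.integral_rieszMeasure Λ (q.mulTent R)
  have habs : ∀ (q : ℝ[X]) (x : ℝ), |q.eval x| ≤ (1 + q ^ 2).eval x := fun q x => by
    simp only [eval_add, eval_one, eval_pow]
    rw [abs_le]
    constructor <;> nlinarith [sq_nonneg (q.eval x + 1), sq_nonneg (q.eval x - 1)]
  have hint : ∀ q : ℝ[X], Integrable (fun x => q.eval x) μ := fun q => by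
    refine (aecover_Icc (tendsto_neg_atTop_atBot.comp tendsto_id) tendsto_id
      (l := (atTop : Filter ℝ))).integrable_of_integral_norm_bounded (L (1 + q ^ 2))
      (fun R => q.continuous.continuousOn.integrableOn_compact isCompact_Icc)
      (Eventually.of_forall fun R => ?_)
    have hi : Integrable (fun x => (1 + q ^ 2).eval x * tent R x) μ :=
      ((1 + q ^ 2).continuous.mul (continuous_tent R)).integrable_of_hasCompactSupport
        (hasCompactSupport_tent R).mul_left
    have hnn : ∀ x, 0 ≤ (1 + q ^ 2).eval x := fun x => (abs_nonneg _).trans (habs q x)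
    calc ∫ x in Set.Icc ((Neg.neg ∘ id) R) (id R), ‖q.eval x‖ ∂μ
        ≤ ∫ x in Set.Icc ((Neg.neg ∘ id) R) (id R), (1 + q ^ 2).eval x * tent R x ∂μ := by
          refine setIntegral_mono_on
            (q.continuous.norm.continuousOn.integrableOn_compact isCompact_Icc)
            hi.integrableOn measurableSet_Icc fun x hx => ?_
          rw [tent_eq_one (R := R) (abs_le.mpr hx), mul_one]
          exact habs q x
      _ ≤ ∫ x, (1 + q ^ 2).eval x * tent R x ∂μ :=
          setIntegral_le_integral hi
            (Eventually.of_forall fun x => mul_nonneg (hnn x) (tent_nonneg R x))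
      _ = Λ ((1 + q ^ 2).mulTent R) := hμ _ R
      _ ≤ L (1 + q ^ 2) := hle _ _ fun x =>
          mul_le_of_le_one_right (hnn x) (tent_le_one R x)
  refine ⟨μ, fun q => ⟨hint q, ?_⟩⟩
  have hlim : Tendsto (fun R => ∫ x, q.eval x * tent R x ∂μ) atTop (𝓝 (∫ x, q.eval x ∂μ)) := by
    refine tendsto_integral_filter_of_dominated_convergence (fun x => |q.eval x|)
      (Eventually.of_forall fun R =>
        (q.continuous.mul (continuous_tent R)).aestronglyMeasurable)
      (Eventually.of_forall fun R => Eventually.of_forall fun x => ?_) (hint q).abs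
      (Eventually.of_forall fun x => ?_)
    · rw [norm_mul, Real.norm_eq_abs, Real.norm_of_nonneg (tent_nonneg R x)]
      exact mul_le_of_le_one_right (abs_nonneg _) (tent_le_one R x)
    · refine tendsto_const_nhds.congr' ?_
      filter_upwards [eventually_ge_atTop |x|] with R hR
      rw [tent_eq_one hR, mul_one]
  refine tendsto_nhds_unique hlim ?_
  set w : ℝ[X] := (1 + q ^ 2) * X ^ 2 with hw
  have hbound : ∀ R : ℝ, 0 < R → ∀ x, |q.eval x * tent R x - q.eval x| ≤
      ((R ^ 2)⁻¹ • w).eval x := fun R hR x => by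
    have h1 : |q.eval x * tent R x - q.eval x| = |q.eval x| * (1 - tent R x) := by
      rw [abs_sub_comm, ← mul_one_sub, abs_mul, abs_of_nonneg (sub_nonneg.mpr (tent_le_one R x))]
    have h2 : ((R ^ 2)⁻¹ • w).eval x = (1 + q ^ 2).eval x * (x ^ 2 / R ^ 2) := by
      rw [eval_smul, hw, eval_mul, eval_pow, eval_X, smul_eq_mul]
      ring
    rw [h1, h2]
    exact mul_le_mul (habs q x) (one_sub_tent_le hR x) (sub_nonneg.mpr (tent_le_one R x))
      ((abs_nonneg _).trans (habs q x))
  have hdec : Tendsto (fun R : ℝ => (R ^ 2)⁻¹ * L w) atTop (𝓝 0) := by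
    simpa using ((tendsto_pow_atTop two_ne_zero).inv_tendsto_atTop).mul_const (L w)
  refine tendsto_iff_dist_tendsto_zero.mpr (squeeze_zero' (Eventually.of_forall fun R =>
    dist_nonneg) ?_ hdec)
  filter_upwards [eventually_gt_atTop 0] with R hR
  have hb := hbound R hR
  have hup := hle (q.mulTent R) (q + (R ^ 2)⁻¹ • w) fun x => by
    have := (abs_le.mp (hb x)).2
    rw [Polynomial.mulTent_apply, eval_add]
    linarith
  have hlo := hge (q.mulTent R) (q - (R ^ 2)⁻¹ • w) fun x => by
    have := (abs_le.mp (hb x)).1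
    rw [Polynomial.mulTent_apply, eval_sub]
    linarith
  rw [map_add, map_smul, smul_eq_mul] at hup
  rw [map_sub, map_smul, smul_eq_mul] at hlo
  rw [hμ, Real.dist_eq, abs_le]
  constructor <;> linarith

/-- Polynomials satisfying a three-term recurrence with `aₙ cₙ₊₁ > 0` are orthogonal with respect
to a linear functional that is positive on their squares. -/
theorem exists_orthogonality_functional
    (p : ℕ → ℝ[X]) (hdeg : ∀ n, (p n).degree = n) (a b c : ℕ → ℝ)
    (hrec0 : X * p 0 = a 0 • p 1 + b 0 • p 0)
    (hrec : ∀ n, X * p (n + 1) =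
      a (n + 1) • p (n + 2) + b (n + 1) • p (n + 1) + c (n + 1) • p n)
    (hpos : ∀ n, 0 < a n * c (n + 1)) :
    ∃ L : ℝ[X] →ₗ[ℝ] ℝ, (∀ m n, m ≠ n → L (p m * p n) = 0) ∧ (∀ n, 0 < L (p n ^ 2)) ∧
      ∀ q, 0 ≤ L (q ^ 2) := by
  let S : Polynomial.Sequence ℝ := ⟨p, hdeg⟩
  have hS : ∀ i, IsUnit (S i).leadingCoeff := fun i => by simp
  let B := S.basis hS
  have hB : ∀ i, B i = p i := fun i => by simp [B, S]
  let L : ℝ[X] →ₗ[ℝ] ℝ := (p 0).coeff 0 • B.coord 0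
  have hL : ∀ n, n ≠ 0 → L (p n) = 0 := fun n hn => by
    simp [L, ← hB, hn.symm]
  have hX : ∀ k n, k < n → L (X ^ k * p n) = 0 := by
    intro k
    induction k with
    | zero => intro n hn; simpa using hL n hn.ne'
    | succ k ih =>
      intro n hn
      obtain ⟨n, rfl⟩ := Nat.exists_eq_succ_of_ne_zero (Nat.ne_zero_of_lt hn)
      rw [pow_succ, mul_assoc, Nat.succ_eq_add_one, hrec]
      simp only [mul_add, mul_smul_comm, map_add, map_smul]
      rw [ih _ (by lia), ih _ (by lia), ih _ (by lia)]
      simp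
  have hlt : ∀ m n, m < n → L (p m * p n) = 0 := fun m n h => by
    rw [(p m).as_sum_range_C_mul_X_pow, Finset.sum_mul, map_sum]
    refine Finset.sum_eq_zero fun k hk => ?_
    rw [natDegree_eq_of_degree_eq_some (hdeg m), Finset.mem_range] at hk
    rw [mul_assoc, ← smul_eq_C_mul, map_smul, hX k n (by lia), smul_zero]
  have hne : ∀ m n, m ≠ n → L (p m * p n) = 0 := fun m n h => by
    rcases h.lt_or_gt with h | h
    · exact hlt m n h
    · rw [mul_comm]; exact hlt n m h
  have hstep : ∀ n, a n * L (p (n + 1) ^ 2) = c (n + 1) * L (p n ^ 2) := fun n => by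
    have h1 : L (X * p n * p (n + 1)) = a n * L (p (n + 1) ^ 2) := by
      cases n with
      | zero =>
        rw [hrec0]
        simp only [add_mul, smul_mul_assoc, map_add, map_smul, smul_eq_mul]
        rw [hne 0 1 (by lia), sq]
        simp
      | succ n =>
        rw [hrec]
        simp only [add_mul, smul_mul_assoc, map_add, map_smul, smul_eq_mul]
        rw [hne (n + 1) (n + 1 + 1) (by lia), hne n (n + 1 + 1) (by lia), sq]
        simp
    have h2 : L (X * p (n + 1) * p n) = c (n + 1) * L (p n ^ 2) := by
      rw [hrec]
      simp only [add_mul, smul_mul_assoc, map_add, map_smul, smul_eq_mul]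
      rw [hne (n + 2) n (by lia), hne (n + 1) n (by lia), sq]
      simp
    rw [← h1, ← h2]
    congr 1
    ring
  have hsq : ∀ n, 0 < L (p n ^ 2) := by
    intro n
    induction n with
    | zero =>
      obtain ⟨t, ht⟩ := natDegree_eq_zero.mp (natDegree_eq_of_degree_eq_some (hdeg 0))
      have ht0 : t ≠ 0 := by
        rintro rfl
        have := hdeg 0
        simp [← ht] at this
      have : p 0 ^ 2 = t • B 0 := by rw [hB, ← ht, smul_eq_C_mul, sq]
      rw [this]
      simp only [L, ← ht, map_smul, LinearMap.smul_apply, B.coord_apply, B.repr_self,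
        Finsupp.single_eq_same, coeff_C_zero, smul_eq_mul, mul_one]
      exact mul_self_pos.mpr ht0
    | succ n ih =>
      have h1 := hstep n
      have h2 := hpos n
      have ha : a n ≠ 0 := fun h => by simp [h] at h2
      have h3 : a n ^ 2 * L (p (n + 1) ^ 2) = a n * c (n + 1) * L (p n ^ 2) := by
        rw [sq, mul_assoc, h1, mul_assoc]
      have h4 := mul_pos h2 ih
      rw [← h3] at h4
      exact pos_of_mul_pos_right h4 (sq_nonneg _)
  refine ⟨L, hne, hsq, fun q => ?_⟩
  have hq := B.linearCombination_repr q
  rw [Finsupp.linearCombination_apply, Finsupp.sum] at hq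
  rw [← hq, sq, Finset.sum_mul_sum, map_sum]
  refine Finset.sum_nonneg fun i hi => ?_
  rw [map_sum]
  refine Finset.sum_nonneg fun j hj => ?_
  rw [smul_mul_smul_comm, map_smul, hB, hB, smul_eq_mul]
  rcases eq_or_ne i j with rfl | hij
  · rw [← sq (p i)]
    exact mul_nonneg (mul_self_nonneg _) (hsq i).le
  · rw [hne i j hij, mul_zero]

/-- **Favard's theorem.** If polynomials `pₙ` of degree `n` satisfy a three-term
recurrence `x·pₙ(x) = aₙ p_{n+1}(x) + bₙ pₙ(x) + cₙ p_{n-1}(x)` with real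
coefficients such that `aₙ c_{n+1} > 0`, then there is a positive Borel measure `μ`
on `ℝ` with all moments finite with respect to which the `pₙ` are orthogonal. -/
theorem favard
    (p : ℕ → Polynomial ℝ)
    (hdeg : ∀ n : ℕ, (p n).degree = n)
    (a b c : ℕ → ℝ)
    (hrec0 : ∀ x : ℝ, x * (p 0).eval x = a 0 * (p 1).eval x + b 0 * (p 0).eval x)
    (hrec : ∀ n : ℕ, 1 ≤ n → ∀ x : ℝ,
      x * (p n).eval x =
        a n * (p (n + 1)).eval x + b n * (p n).eval x + c n * (p (n - 1)).eval x)
    (hpos : ∀ n : ℕ, 0 < a n * c (n + 1)) :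
    ∃ μ : Measure ℝ,
      (∀ n : ℕ, Integrable (fun x : ℝ => |x| ^ n) μ) ∧
      (∀ m n : ℕ, m ≠ n → ∫ x, (p m).eval x * (p n).eval x ∂μ = 0) ∧
      (∀ n : ℕ, 0 < ∫ x, (p n).eval x ^ 2 ∂μ) := by
  obtain ⟨L, hne, hsq, hnn⟩ := exists_orthogonality_functional p hdeg a b c
    (Polynomial.funext fun x => by simpa [smul_eq_mul] using hrec0 x)
    (fun n => Polynomial.funext fun x => by simpa [smul_eq_mul] using hrec (n + 1) (by lia) x) hpos
  obtain ⟨μ, hμ⟩ := exists_measure_integral_eval_eq L hnn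
  refine ⟨μ, fun n => ?_, fun m n hmn => ?_, fun n => ?_⟩
  · simpa [abs_pow] using (hμ (X ^ n)).1.abs
  · simpa [eval_mul, hne m n hmn] using (hμ (p m * p n)).2
  · simpa only [← (hμ (p n ^ 2)).2, eval_pow] using hsq n
end

section
/- (Carleman's criterion) Let μ and ν be finite positive Borel measures on ℝ with all moments finite and equal: μ_n := ∫ x^n dμ(x) = ∫ x^n dν(x) for all n ≥ 0. If ∑_{n=1}^{∞} μ_{2n}^{−1/(2n)} = ∞, then μ = ν. -/
open MeasureTheory

section CarlemanInequality

/-- The geometric mean of `b 0, …, b n` is controlled by a weighted arithmetic mean. -/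
lemma geom_mean_le_weighted_sum {b : ℕ → ℝ} (hb : ∀ n, 0 ≤ b n) (n : ℕ) :
    (∏ i ∈ Finset.range (n + 1), b i) ^ (1 / ((n : ℝ) + 1)) ≤
      2 * Real.exp 1 * ((∑ i ∈ Finset.range (n + 1), ((i : ℝ) + 1) * b i) /
        (((n : ℝ) + 1) * ((n : ℝ) + 2))) := by
  have hN : (0 : ℝ) < (n : ℝ) + 1 := by positivity
  have hS : 0 ≤ ∑ i ∈ Finset.range (n + 1), ((i : ℝ) + 1) * b i :=
    Finset.sum_nonneg fun i _ => mul_nonneg (by positivity) (hb i)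
  have hP : 0 ≤ ∏ i ∈ Finset.range (n + 1), b i := Finset.prod_nonneg fun i _ => hb i
  have amgm := Real.geom_mean_le_arith_mean (Finset.range (n + 1)) (fun _ => (1 : ℝ))
    (fun i => ((i : ℝ) + 1) * b i) (fun _ _ => zero_le_one) (by simp; positivity)
    (fun i _ => mul_nonneg (by positivity) (hb i))
  have hfac : ∏ i ∈ Finset.range (n + 1), ((i : ℝ) + 1) = ((n + 1).factorial : ℝ) := by
    rw [← Finset.prod_range_add_one_eq_factorial]; push_cast; rfl
  simp only [Real.rpow_one, Finset.prod_mul_distrib, hfac, Finset.sum_const, Finset.card_range,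
    nsmul_eq_mul, mul_one, one_mul] at amgm
  push_cast at amgm
  rw [Real.mul_rpow (by positivity) hP, ← one_div] at amgm
  have hroot : ((n : ℝ) + 1) / Real.exp 1 ≤
      ((n + 1).factorial : ℝ) ^ (1 / ((n : ℝ) + 1)) := by
    have h := Real.pow_div_factorial_le_exp (x := (n : ℝ) + 1) hN.le (n + 1)
    rw [div_le_iff₀ (by positivity)] at h
    have h' : (((n : ℝ) + 1) / Real.exp 1) ^ (n + 1) ≤ ((n + 1).factorial : ℝ) := by
      rw [div_pow, ← Real.exp_nat_mul, div_le_iff₀ (by positivity)]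
      push_cast
      rw [mul_one]
      linarith
    calc ((n : ℝ) + 1) / Real.exp 1
        = ((((n : ℝ) + 1) / Real.exp 1) ^ (n + 1)) ^ (1 / ((n : ℝ) + 1)) := by
          rw [← Real.rpow_natCast, ← Real.rpow_mul (by positivity)]
          push_cast
          rw [mul_one_div_cancel hN.ne', Real.rpow_one]
      _ ≤ _ := Real.rpow_le_rpow (by positivity) h' (by positivity)
  set P := (∏ i ∈ Finset.range (n + 1), b i) ^ (1 / ((n : ℝ) + 1))
  set S := ∑ i ∈ Finset.range (n + 1), ((i : ℝ) + 1) * b i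
  have hP' : 0 ≤ P := Real.rpow_nonneg hP _
  have key : ((n : ℝ) + 1) / Real.exp 1 * P ≤ S / ((n : ℝ) + 1) :=
    (mul_le_mul_of_nonneg_right hroot hP').trans amgm
  have hPle : P ≤ Real.exp 1 * (S / (((n : ℝ) + 1) * ((n : ℝ) + 1))) := by
    rw [div_mul_eq_mul_div, div_le_iff₀ (Real.exp_pos 1)] at key
    rw [← div_div, mul_div_assoc', le_div_iff₀ hN]
    linarith
  refine hPle.trans ?_
  rw [mul_comm 2, mul_assoc]
  refine mul_le_mul_of_nonneg_left ?_ (Real.exp_pos 1).le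
  rw [mul_div_assoc', div_le_div_iff₀ (by positivity) (by positivity)]
  have : 0 ≤ S * (((n : ℝ) + 1) * n) := by positivity
  nlinarith

lemma sum_range_weighted_sum_eq (b : ℕ → ℝ) (N : ℕ) :
    ∑ n ∈ Finset.range N, (∑ i ∈ Finset.range (n + 1), ((i : ℝ) + 1) * b i) /
        (((n : ℝ) + 1) * ((n : ℝ) + 2)) =
      ∑ i ∈ Finset.range N, b i -
        (∑ i ∈ Finset.range N, ((i : ℝ) + 1) * b i) / ((N : ℝ) + 1) := by
  induction N with
  | zero => simp
  | succ N ih =>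
    rw [Finset.sum_range_succ, ih, Finset.sum_range_succ _ N, Finset.sum_range_succ _ N]
    have h1 : (N : ℝ) + 1 ≠ 0 := by positivity
    have h2 : (N : ℝ) + 2 ≠ 0 := by positivity
    have h3 : (N : ℝ) + 1 + 1 ≠ 0 := by positivity
    push_cast
    field_simp
    ring

lemma prod_range_div_succ {M : ℕ → ℝ} (hM : ∀ n, M n ≠ 0) (N : ℕ) :
    ∏ i ∈ Finset.range N, M i / M (i + 1) = M 0 / M N := by
  induction N with
  | zero => simp [hM 0]
  | succ N ih => rw [Finset.prod_range_succ, ih, div_mul_div_cancel₀ (hM N)]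

/-- **Carleman's inequality**, qualitative form: the geometric means of a summable nonnegative
sequence are summable. -/
theorem summable_geom_mean {b : ℕ → ℝ} (hb : ∀ n, 0 ≤ b n) (hs : Summable b) :
    Summable fun n : ℕ => (∏ i ∈ Finset.range (n + 1), b i) ^ (1 / ((n : ℝ) + 1)) := by
  have hw : ∀ N : ℕ, 0 ≤ ∑ i ∈ Finset.range N, ((i : ℝ) + 1) * b i := fun N =>
    Finset.sum_nonneg fun i _ => mul_nonneg (by positivity) (hb i)
  refine Summable.of_nonneg_of_le
    (fun n => Real.rpow_nonneg (Finset.prod_nonneg fun i _ => hb i) _)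
    (geom_mean_le_weighted_sum hb) (Summable.mul_left _ ?_)
  refine summable_of_sum_range_le (c := ∑' i, b i)
    (fun n => div_nonneg (hw _) (by positivity)) fun N => ?_
  rw [sum_range_weighted_sum_eq]
  have := hs.sum_le_tsum (Finset.range N) fun i _ => hb i
  have : 0 ≤ (∑ i ∈ Finset.range N, ((i : ℝ) + 1) * b i) / ((N : ℝ) + 1) :=
    div_nonneg (hw N) (by positivity)
  linarith

end CarlemanInequality

section Quasianalytic

lemma le_mul_ratio_pow_of_logConvex {M : ℕ → ℝ} (hM : ∀ n, 0 < M n)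
    (hconv : ∀ n, M (n + 1) ^ 2 ≤ M n * M (n + 2)) {n i k : ℕ} (h : n + i ≤ k + 1) :
    M (n + i) ≤ M n * (M (k + 1) / M k) ^ i := by
  have hmono : Monotone fun n => M (n + 1) / M n := by
    refine monotone_nat_of_le_succ fun n => ?_
    rw [div_le_div_iff₀ (hM _) (hM _)]
    have := hconv n
    ring_nf at this ⊢
    linarith
  induction i with
  | zero => simp
  | succ i ih =>
    have h1 : M (n + i + 1) / M (n + i) ≤ M (k + 1) / M k := hmono (by omega)
    rw [div_le_iff₀ (hM _)] at h1
    calc M (n + (i + 1)) ≤ M (k + 1) / M k * M (n + i) := h1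
      _ ≤ M (k + 1) / M k * (M n * (M (k + 1) / M k) ^ i) :=
        mul_le_mul_of_nonneg_left (ih (by omega)) (div_pos (hM _) (hM _)).le
      _ = _ := by ring

/-- One step of Bang's argument: moving the base point by at most `M k / (e * M (k + 1))` costs
at most a factor `e`. -/
lemma norm_le_exp_of_taylor_step {F : ℕ → ℝ → ℂ} {M : ℕ → ℝ} (hM : ∀ n, 0 < M n)
    (hconv : ∀ n, M (n + 1) ^ 2 ≤ M n * M (n + 2)) (hF : ∀ n t, ‖F n t‖ ≤ M n)
    (htaylor : ∀ n k t h, ‖F n (t + h) -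
      ∑ i ∈ Finset.range k, (h : ℂ) ^ i / (i.factorial : ℂ) * F (n + i) t‖ ≤
        |h| ^ k / k.factorial * M (n + k))
    {k : ℕ} {x h : ℝ} (hx : ∀ n, ‖F n x‖ ≤ Real.exp ((n : ℝ) - ((k : ℝ) + 1)) * M n)
    (hh : |h| ≤ Real.exp (-1) * (M k / M (k + 1))) (n : ℕ) :
    ‖F n (x + h)‖ ≤ Real.exp ((n : ℝ) - k) * M n := by
  rcases le_or_gt k n with hkn | hkn
  · refine (hF n _).trans (le_mul_of_one_le_left (hM n).le (Real.one_le_exp ?_))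
    have : (k : ℝ) ≤ n := by exact_mod_cast hkn
    linarith
  obtain ⟨j, hj⟩ : ∃ j, k + 1 = n + j := ⟨k + 1 - n, by omega⟩
  set r := M (k + 1) / M k with hr
  have hr0 : 0 < r := div_pos (hM _) (hM _)
  set u := |h| * Real.exp 1 * r with hu
  have hu0 : 0 ≤ u := by positivity
  have hu1 : u ≤ 1 := by
    calc u ≤ Real.exp (-1) * (M k / M (k + 1)) * Real.exp 1 * r := by
          rw [hu]; gcongr
      _ = (Real.exp (-1) * Real.exp 1) * (M k / M (k + 1) * (M (k + 1) / M k)) := by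
          rw [hr]; ring
      _ = 1 := by
          rw [← Real.exp_add, div_mul_div_cancel₀ (hM _).ne', div_self (hM _).ne']
          simp
  have hterm : ∀ i ≤ j, |h| ^ i / i.factorial *
      (Real.exp (((n + i : ℕ) : ℝ) - ((k : ℝ) + 1)) * M (n + i)) ≤
      Real.exp ((n : ℝ) - ((k : ℝ) + 1)) * M n * (u ^ i / i.factorial) := by
    intro i hi
    have h1 := le_mul_ratio_pow_of_logConvex hM hconv (n := n) (i := i) (k := k) (by omega)
    have h2 : Real.exp (((n + i : ℕ) : ℝ) - ((k : ℝ) + 1)) =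
        Real.exp ((n : ℝ) - ((k : ℝ) + 1)) * Real.exp 1 ^ i := by
      rw [← Real.exp_nat_mul, ← Real.exp_add]
      push_cast
      ring_nf
    rw [h2]
    calc _ ≤ |h| ^ i / i.factorial *
        (Real.exp ((n : ℝ) - ((k : ℝ) + 1)) * Real.exp 1 ^ i * (M n * r ^ i)) := by gcongr
      _ = _ := by rw [hu]; ring
  have hsum : ‖∑ i ∈ Finset.range j, (h : ℂ) ^ i / (i.factorial : ℂ) * F (n + i) x‖ ≤
      ∑ i ∈ Finset.range j,
        Real.exp ((n : ℝ) - ((k : ℝ) + 1)) * M n * (u ^ i / i.factorial) := by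
    refine norm_sum_le_of_le _ fun i hi => ?_
    refine le_trans ?_ (hterm i (Finset.mem_range.1 hi).le)
    rw [norm_mul, norm_div, norm_pow, Complex.norm_real, Real.norm_eq_abs, Complex.norm_natCast]
    gcongr
    exact hx _
  have hrem : |h| ^ j / j.factorial * M (n + j) ≤
      Real.exp ((n : ℝ) - ((k : ℝ) + 1)) * M n * (u ^ j / j.factorial) := by
    refine le_trans (le_of_eq ?_) (hterm j le_rfl)
    rw [← hj]
    push_cast
    simp
  calc ‖F n (x + h)‖ = ‖(F n (x + h) -
        ∑ i ∈ Finset.range j, (h : ℂ) ^ i / (i.factorial : ℂ) * F (n + i) x) +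
        ∑ i ∈ Finset.range j, (h : ℂ) ^ i / (i.factorial : ℂ) * F (n + i) x‖ := by
        rw [sub_add_cancel]
    _ ≤ Real.exp ((n : ℝ) - ((k : ℝ) + 1)) * M n * (u ^ j / j.factorial) +
        ∑ i ∈ Finset.range j,
          Real.exp ((n : ℝ) - ((k : ℝ) + 1)) * M n * (u ^ i / i.factorial) :=
        (norm_add_le _ _).trans (add_le_add ((htaylor n j x h).trans hrem) hsum)
    _ = Real.exp ((n : ℝ) - ((k : ℝ) + 1)) * M n *
        ∑ i ∈ Finset.range (j + 1), u ^ i / i.factorial := by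
        rw [Finset.sum_range_succ, mul_add, Finset.mul_sum, add_comm]
    _ ≤ Real.exp ((n : ℝ) - ((k : ℝ) + 1)) * M n * Real.exp 1 := by
        have := hM n
        gcongr
        exact (Real.sum_le_exp_of_nonneg hu0 _).trans (Real.exp_le_exp.2 hu1)
    _ = Real.exp ((n : ℝ) - k) * M n := by
        rw [mul_right_comm, ← Real.exp_add]
        ring_nf

/-- **Denjoy–Carleman theorem** (sufficiency), for a sequence `F` playing the role of the successive
derivatives of a smooth function, bounded by a log-convex sequence `M`. -/
theorem eq_zero_of_not_summable_ratio {F : ℕ → ℝ → ℂ} {M : ℕ → ℝ} (hM : ∀ n, 0 < M n)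
    (hconv : ∀ n, M (n + 1) ^ 2 ≤ M n * M (n + 2)) (hF : ∀ n t, ‖F n t‖ ≤ M n)
    (htaylor : ∀ n k t h, ‖F n (t + h) -
      ∑ i ∈ Finset.range k, (h : ℂ) ^ i / (i.factorial : ℂ) * F (n + i) t‖ ≤
        |h| ^ k / k.factorial * M (n + k))
    (hdiv : ¬ Summable fun n => M n / M (n + 1)) (hzero : ∀ n, F n 0 = 0) (n : ℕ) (t : ℝ) :
    F n t = 0 := by
  set η : ℕ → ℝ := fun k => Real.exp (-1) * (M k / M (k + 1)) with hη
  have hη0 : ∀ k, 0 ≤ η k := fun k => by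
    have h1 := hM k
    have h2 := hM (k + 1)
    positivity
  have hηdiv : ¬ Summable η := by
    rwa [hη, summable_mul_left_iff (Real.exp_ne_zero _)]
  have iterate : ∀ (k : ℕ) (θ : ℝ), |θ| ≤ 1 → ∀ (m : ℕ) (x : ℝ),
      (∀ n, ‖F n x‖ ≤ Real.exp ((n : ℝ) - ((k + m : ℕ) : ℝ)) * M n) →
      ∀ n, ‖F n (x + θ * ∑ i ∈ Finset.range m, η (i + k))‖ ≤ Real.exp ((n : ℝ) - k) * M n := by
    intro k θ hθ m
    induction m with
    | zero => intro x hx; simpa using hx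
    | succ m ih =>
      intro x hx
      rw [Finset.sum_range_succ, add_comm (∑ i ∈ Finset.range m, η (i + k)), mul_add, ← add_assoc]
      refine ih _ (norm_le_exp_of_taylor_step hM hconv hF htaylor (fun n => ?_) ?_)
      · have := hx n
        push_cast at this ⊢
        rwa [← add_assoc] at this
      · rw [abs_mul, abs_of_nonneg (hη0 _), add_comm m k]
        exact mul_le_of_le_one_left (hη0 _) hθ
  have hbound : ∀ k : ℕ, ‖F n t‖ ≤ Real.exp ((n : ℝ) - k) * M n := by
    intro k
    have htend := (not_summable_iff_tendsto_nat_atTop_of_nonneg (fun i => hη0 (i + k))).1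
      (fun h => hηdiv ((summable_nat_add_iff k).1 h))
    obtain ⟨m, hm⟩ := (htend.eventually_ge_atTop (|t| + 1)).exists
    have hpos : 0 < ∑ i ∈ Finset.range m, η (i + k) := by
      have := abs_nonneg t
      linarith
    have := iterate k (t / ∑ i ∈ Finset.range m, η (i + k))
      (by rw [abs_div, abs_of_pos hpos, div_le_one hpos]; linarith) m 0
      (fun n => by
        rw [hzero, norm_zero]
        exact mul_nonneg (Real.exp_pos _).le (hM n).le) n
    rwa [zero_add, div_mul_cancel₀ _ hpos.ne'] at this
  have hlim : Filter.Tendsto (fun k : ℕ => Real.exp ((n : ℝ) - k) * M n) Filter.atTop (nhds 0) := by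
    have h1 : Filter.Tendsto (fun k : ℕ => (n : ℝ) - k) Filter.atTop Filter.atBot :=
      tendsto_const_nhds.add_atBot
        (Filter.tendsto_neg_atTop_atBot.comp tendsto_natCast_atTop_atTop)
    simpa using (Real.tendsto_exp_atBot.comp h1).mul_const (M n)
  exact norm_le_zero_iff.1 (ge_of_tendsto' hlim hbound)

end Quasianalytic

section Fourier

/-- Taylor's formula for `s ↦ exp (i s)` with the sharp remainder bound. -/
lemma norm_exp_I_mul_sub_sum_le (y : ℝ) (k : ℕ) :
    ‖Complex.exp (Complex.I * y) -
      ∑ i ∈ Finset.range k, (Complex.I * y) ^ i / (i.factorial : ℂ)‖ ≤ |y| ^ k / k.factorial := by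
  suffices H : ∀ s : ℝ, 0 ≤ s → ‖Complex.exp (Complex.I * y * s) -
      ∑ i ∈ Finset.range k, (Complex.I * y * s) ^ i / (i.factorial : ℂ)‖ ≤
        |y| ^ k * s ^ k / k.factorial by
    simpa using H 1 zero_le_one
  induction k with
  | zero =>
    intro s _
    have : Complex.I * y * s = ((y * s : ℝ) : ℂ) * Complex.I := by push_cast; ring
    simp [this, Complex.norm_exp_ofReal_mul_I, -Complex.ofReal_mul]
  | succ k ih =>
    intro s hs
    set z : ℂ := Complex.I * y with hz
    have hzn : ‖z‖ = |y| := by simp [hz]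
    have hd : ∀ r : ℝ, HasDerivAt (fun r : ℝ => Complex.exp (z * r) -
        ∑ i ∈ Finset.range (k + 1), (z * r) ^ i / (i.factorial : ℂ))
        (z * (Complex.exp (z * r) - ∑ i ∈ Finset.range k, (z * r) ^ i / (i.factorial : ℂ))) r := by
      intro r
      have hlin : HasDerivAt (fun r : ℝ => z * (r : ℂ)) z r := by
        simpa using (Complex.ofRealCLM.hasDerivAt (x := r)).const_mul z
      have hsum : HasDerivAt (fun r : ℝ => ∑ i ∈ Finset.range (k + 1),
          (z * (r : ℂ)) ^ i / (i.factorial : ℂ))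
          (∑ i ∈ Finset.range (k + 1),
            (i : ℂ) * (z * r) ^ (i - 1) * z / (i.factorial : ℂ)) r :=
        HasDerivAt.fun_sum fun i _ => (hlin.fun_pow i).div_const _
      refine (hlin.cexp.fun_sub hsum).congr_deriv (Eq.symm ?_)
      rw [Finset.sum_range_succ', mul_sub, Finset.mul_sum]
      simp only [Nat.cast_zero, zero_mul, zero_div, add_zero, Nat.add_sub_cancel]
      congr 1
      · ring
      · refine Finset.sum_congr rfl fun i _ => ?_
        have h1 : ((i : ℂ) + 1) ≠ 0 := by exact_mod_cast i.succ_ne_zero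
        have h2 : (i.factorial : ℂ) ≠ 0 := by exact_mod_cast i.factorial_ne_zero
        rw [Nat.factorial_succ]
        push_cast
        field_simp
    have hB : ∀ r : ℝ, HasDerivAt (fun r : ℝ => |y| ^ (k + 1) * r ^ (k + 1) / (k + 1).factorial)
        (|y| * (|y| ^ k * r ^ k / k.factorial)) r := by
      intro r
      refine ((((hasDerivAt_id r).fun_pow (k + 1)).const_mul (|y| ^ (k + 1))).div_const
        ((k + 1).factorial : ℝ)).congr_deriv (Eq.symm ?_)
      have h1 : ((k : ℝ) + 1) ≠ 0 := by positivity
      have h2 : (k.factorial : ℝ) ≠ 0 := by positivity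
      rw [Nat.factorial_succ]
      simp only [id, Nat.add_sub_cancel, mul_one]
      push_cast
      field_simp
      ring
    refine image_norm_le_of_norm_deriv_right_le_deriv_boundary (a := 0) (b := s)
      (fun r _ => (hd r).continuousAt.continuousWithinAt)
      (fun r _ => (hd r).hasDerivWithinAt) ?_ hB (fun r hr => ?_) ⟨hs, le_rfl⟩
    · simp [Finset.sum_range_succ']
    · rw [norm_mul, hzn]
      exact mul_le_mul_of_nonneg_left (ih r hr.1) (abs_nonneg y)

/-- The candidate for the `n`-th derivative of the characteristic function of `μ`. -/
noncomputable def charFunDeriv (μ : Measure ℝ) (n : ℕ) (t : ℝ) : ℂ :=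
  ∫ x, (Complex.I * (x : ℂ)) ^ n * Complex.exp (Complex.I * ((t * x : ℝ) : ℂ)) ∂μ

lemma norm_exp_I_mul_real (y : ℝ) : ‖Complex.exp (Complex.I * (y : ℂ))‖ = 1 := by
  rw [mul_comm]; exact Complex.norm_exp_ofReal_mul_I y

variable {μ : Measure ℝ}

lemma norm_charFunDeriv_integrand (n : ℕ) (t x : ℝ) :
    ‖(Complex.I * (x : ℂ)) ^ n * Complex.exp (Complex.I * ((t * x : ℝ) : ℂ))‖ = |x| ^ n := by
  rw [norm_mul, norm_exp_I_mul_real]; simp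

lemma integrable_charFunDeriv_integrand (hμ : ∀ n : ℕ, Integrable (fun x : ℝ => |x| ^ n) μ)
    (n : ℕ) (t : ℝ) : Integrable (fun x : ℝ =>
      (Complex.I * (x : ℂ)) ^ n * Complex.exp (Complex.I * ((t * x : ℝ) : ℂ))) μ :=
  (hμ n).mono' (Continuous.aestronglyMeasurable (by fun_prop))
    (.of_forall fun x => (norm_charFunDeriv_integrand n t x).le)

lemma norm_charFunDeriv_le (n : ℕ) (t : ℝ) : ‖charFunDeriv μ n t‖ ≤ ∫ x, |x| ^ n ∂μ := by
  refine (norm_integral_le_integral_norm _).trans (le_of_eq ?_)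
  simp_rw [norm_charFunDeriv_integrand]

lemma norm_charFunDeriv_sub_taylor_le (hμ : ∀ n : ℕ, Integrable (fun x : ℝ => |x| ^ n) μ)
    (n k : ℕ) (t h : ℝ) :
    ‖charFunDeriv μ n (t + h) -
      ∑ i ∈ Finset.range k, (h : ℂ) ^ i / (i.factorial : ℂ) * charFunDeriv μ (n + i) t‖ ≤
        |h| ^ k / k.factorial * ∫ x, |x| ^ (n + k) ∂μ := by
  unfold charFunDeriv
  simp_rw [← integral_const_mul]
  rw [← integral_finsetSum _ fun i _ => (integrable_charFunDeriv_integrand hμ (n + i) t).const_mul _,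
    ← integral_sub (integrable_charFunDeriv_integrand hμ n (t + h))
      (integrable_finsetSum _ fun i _ =>
        (integrable_charFunDeriv_integrand hμ (n + i) t).const_mul _)]
  refine norm_integral_le_of_norm_le ((hμ (n + k)).const_mul _) (.of_forall fun x => ?_)
  have hfac : (Complex.I * (x : ℂ)) ^ n * Complex.exp (Complex.I * (((t + h) * x : ℝ) : ℂ)) -
      ∑ i ∈ Finset.range k, (h : ℂ) ^ i / (i.factorial : ℂ) *
        ((Complex.I * (x : ℂ)) ^ (n + i) * Complex.exp (Complex.I * ((t * x : ℝ) : ℂ))) =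
      ((Complex.I * (x : ℂ)) ^ n * Complex.exp (Complex.I * ((t * x : ℝ) : ℂ))) *
        (Complex.exp (Complex.I * ((h * x : ℝ) : ℂ)) -
          ∑ i ∈ Finset.range k, (Complex.I * ((h * x : ℝ) : ℂ)) ^ i / (i.factorial : ℂ)) := by
    rw [mul_sub, Finset.mul_sum, mul_assoc, ← Complex.exp_add]
    congr 1
    · push_cast; ring_nf
    · refine Finset.sum_congr rfl fun i _ => ?_
      push_cast; ring
  rw [hfac, norm_mul, norm_charFunDeriv_integrand]
  calc _ ≤ |x| ^ n * (|h * x| ^ k / k.factorial) :=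
        mul_le_mul_of_nonneg_left (norm_exp_I_mul_sub_sum_le _ _) (by positivity)
    _ = _ := by rw [abs_mul]; ring

lemma charFunDeriv_zero_right (n : ℕ) :
    charFunDeriv μ n 0 = Complex.I ^ n * ((∫ x, x ^ n ∂μ : ℝ) : ℂ) := by
  rw [← integral_complex_ofReal, ← integral_const_mul, charFunDeriv]
  simp [mul_pow]

lemma charFunDeriv_zero_left (t : ℝ) : charFunDeriv μ 0 t = charFun μ t := by
  rw [charFun_apply_real, charFunDeriv]
  congr 1 with x
  push_cast
  ring_nf

end Fourier

section AbsoluteMoments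

lemma integral_abs_pow_sq_le {σ : Measure ℝ} (hσ : ∀ n : ℕ, Integrable (fun x : ℝ => |x| ^ n) σ)
    (n : ℕ) :
    (∫ x, |x| ^ (n + 1) ∂σ) ^ 2 ≤ (∫ x, |x| ^ n ∂σ) * ∫ x, |x| ^ (n + 2) ∂σ := by
  have hquad : ∀ c : ℝ, 0 ≤ (∫ x, |x| ^ n ∂σ) * (c * c) +
      (-2 * ∫ x, |x| ^ (n + 1) ∂σ) * c + ∫ x, |x| ^ (n + 2) ∂σ := by
    intro c
    have h0 : 0 ≤ ∫ x, |x| ^ n * (c - |x|) ^ 2 ∂σ := integral_nonneg fun x => by positivity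
    have h1 : (fun x : ℝ => |x| ^ n * (c - |x|) ^ 2) = fun x =>
        (c * c) * |x| ^ n + (-2 * c) * |x| ^ (n + 1) + |x| ^ (n + 2) := by
      ext x; ring
    rw [h1, integral_add (by fun_prop) (hσ _),
      integral_add ((hσ _).const_mul _) ((hσ _).const_mul _), integral_const_mul,
      integral_const_mul] at h0
    linarith
  have := discrim_le_zero hquad
  rw [discrim] at this
  linarith

lemma integral_pow_eq_zero_of_integral_abs_pow_eq_zero {σ : Measure ℝ} {n : ℕ}
    (hσ : Integrable (fun x : ℝ => |x| ^ n) σ) (h : ∫ x, |x| ^ n ∂σ = 0) {m : ℕ} (hm : m ≠ 0) :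
    ∫ x, x ^ m ∂σ = 0 := by
  rw [integral_eq_zero_iff_of_nonneg (fun x => by positivity) hσ] at h
  refine integral_eq_zero_of_ae (h.mono fun x hx => ?_)
  have hx0 : x = 0 := abs_eq_zero.1 (eq_zero_of_pow_eq_zero hx)
  simp [hx0, hm]

end AbsoluteMoments

/-- **Carleman's criterion.** If two finite positive Borel measures on `ℝ` have the
same (finite) moments `μₙ` and `∑_{n≥1} μ_{2n}^{-1/(2n)} = ∞`, then the two
measures coincide (the moment problem is determinate). -/
theorem carleman_criterion
    (μ ν : Measure ℝ) [IsFiniteMeasure μ] [IsFiniteMeasure ν]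
    (hμ_mom : ∀ n : ℕ, Integrable (fun x : ℝ => |x| ^ n) μ)
    (hν_mom : ∀ n : ℕ, Integrable (fun x : ℝ => |x| ^ n) ν)
    (h_eq : ∀ n : ℕ, ∫ x, x ^ n ∂μ = ∫ x, x ^ n ∂ν)
    (h_carleman : ¬ Summable (fun n : ℕ =>
      (∫ x, x ^ (2 * (n + 1)) ∂μ) ^ (-(1 : ℝ) / (2 * ((n : ℝ) + 1))))) :
    μ = ν := by
  have hσ : ∀ n : ℕ, Integrable (fun x : ℝ => |x| ^ n) (μ + ν) := fun n =>
    (hμ_mom n).add_measure (hν_mom n)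
  set M : ℕ → ℝ := fun n => ∫ x, |x| ^ n ∂(μ + ν) with hMdef
  have hMadd : ∀ n, M n = ∫ x, |x| ^ n ∂μ + ∫ x, |x| ^ n ∂ν := fun n =>
    integral_add_measure (hμ_mom n) (hν_mom n)
  have hMeven : ∀ n, M (2 * n) = 2 * ∫ x, x ^ (2 * n) ∂μ := fun n => by
    simp only [hMadd, (even_two_mul n).pow_abs, ← h_eq]
    ring
  have hM : ∀ n, 0 < M n := by
    intro n
    refine lt_of_le_of_ne (integral_nonneg fun x => by positivity) fun h0 => h_carleman ?_
    have hμ0 : ∫ x, |x| ^ n ∂μ = 0 := by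
      have h1 : 0 ≤ ∫ x, |x| ^ n ∂μ := integral_nonneg fun x => by positivity
      have h2 : 0 ≤ ∫ x, |x| ^ n ∂ν := integral_nonneg fun x => by positivity
      have := hMadd n
      linarith
    convert summable_zero with k
    rw [integral_pow_eq_zero_of_integral_abs_pow_eq_zero (hμ_mom n) hμ0 (by omega),
      Real.zero_rpow]
    exact div_ne_zero (by norm_num) (by positivity)
  have hdiv : ¬ Summable fun n => M n / M (n + 1) := by
    intro hs
    have hgm := summable_geom_mean (fun n => (div_pos (hM n) (hM (n + 1))).le) hs
    simp_rw [prod_range_div_succ fun n => (hM n).ne'] at hgm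
    have hinj : Function.Injective fun n : ℕ => 2 * n + 1 := fun a b h => by
      dsimp at h; omega
    refine h_carleman (Summable.of_nonneg_of_le (fun n => ?_) (fun n => ?_)
      ((hgm.comp_injective hinj).mul_left (1 + 2 / M 0)))
    · exact Real.rpow_nonneg (integral_nonneg fun x => (even_two_mul _).pow_nonneg x) _
    · have h2 : 2 * n + 1 + 1 = 2 * (n + 1) := by ring
      have h3 : ((2 * n + 1 : ℕ) : ℝ) + 1 = 2 * ((n : ℝ) + 1) := by push_cast; ring
      have hpos := hM (2 * (n + 1))
      have h0 := hM 0
      have hval : ∫ x, x ^ (2 * (n + 1)) ∂μ = M (2 * (n + 1)) / 2 := by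
        rw [hMeven]; ring
      have hexp : 1 / (2 * ((n : ℝ) + 1)) ≤ 1 := by
        rw [div_le_one (by positivity)]
        have : (0 : ℝ) ≤ n := n.cast_nonneg
        linarith
      simp only [Function.comp_apply, h2, h3]
      rw [hval, neg_div, Real.rpow_neg (by positivity), ← Real.inv_rpow (by positivity)]
      have hsplit : (M (2 * (n + 1)) / 2)⁻¹ = 2 / M 0 * (M 0 / M (2 * (n + 1))) := by
        field_simp
      rw [hsplit, Real.mul_rpow (by positivity) (by positivity)]
      refine mul_le_mul_of_nonneg_right ?_ (by positivity)
      calc (2 / M 0) ^ (1 / (2 * ((n : ℝ) + 1)))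
          ≤ (1 + 2 / M 0) ^ (1 / (2 * ((n : ℝ) + 1))) :=
            Real.rpow_le_rpow (by positivity) (by linarith) (by positivity)
        _ ≤ (1 + 2 / M 0) ^ (1 : ℝ) := by
            refine Real.rpow_le_rpow_of_exponent_le ?_ hexp
            have : 0 < 2 / M 0 := by positivity
            linarith
        _ = 1 + 2 / M 0 := Real.rpow_one _
  refine Measure.ext_of_charFun (funext fun t => ?_)
  rw [← charFunDeriv_zero_left, ← charFunDeriv_zero_left, ← sub_eq_zero]
  refine eq_zero_of_not_summable_ratio (F := fun n t => charFunDeriv μ n t - charFunDeriv ν n t)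
    hM (integral_abs_pow_sq_le hσ) (fun n t => ?_) (fun n k t h => ?_) hdiv (fun n => ?_) 0 t
  · rw [hMadd]
    exact (norm_sub_le _ _).trans (add_le_add (norm_charFunDeriv_le n t) (norm_charFunDeriv_le n t))
  · rw [hMadd]
    simp_rw [mul_sub, Finset.sum_sub_distrib, mul_add]
    rw [sub_sub_sub_comm]
    exact (norm_sub_le _ _).trans (add_le_add (norm_charFunDeriv_sub_taylor_le hμ_mom n k t h)
      (norm_charFunDeriv_sub_taylor_le hν_mom n k t h))
  · rw [charFunDeriv_zero_right, charFunDeriv_zero_right, h_eq, sub_self]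
end

section
/- (Markov's theorem) Let μ be a positive Borel measure on ℝ with infinite compact support and μ_0 := μ(ℝ), let (p_n)_{n≥0} be the monic orthogonal polynomials with respect to μ with recurrence coefficients b_n, c_n, and let (p_n^{(1)}) be the first associated polynomials (defined by p_0^{(1)} = 1, p_1^{(1)}(x) = x − b_1, x·p_n^{(1)}(x) = p_{n+1}^{(1)}(x) + b_{n+1} p_n^{(1)}(x) + c_{n+1} p_{n−1}^{(1)}(x) for n ≥ 1). Let I be the smallest closed interval containing the support of μ. Then p_{n−1}^{(1)}(z)/p_n(z) converges to (1/μ_0) ∫ dμ(x)/(z − x) as n → ∞, uniformly on compact subsets of ℂ ∖ I. -/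
open MeasureTheory Polynomial

/-- The support of a positive Borel measure on `ℝ`. -/
def measureSupport (μ : Measure ℝ) : Set ℝ := {x : ℝ | ∀ U ∈ nhds x, 0 < μ U}

/-- Every function continuous on a compact set carrying the measure is integrable. -/
lemma integrable_of_continuousOn_of_null_compl {μ : Measure ℝ} [IsFiniteMeasure μ] {S : Set ℝ}
    (hS : IsCompact S) (hnull : μ Sᶜ = 0) {f : ℝ → ℂ} (hf : ContinuousOn f S) :
    Integrable f μ := by
  have h1 : IntegrableOn f S μ := hf.integrableOn_compact hS
  rwa [IntegrableOn, Measure.restrict_eq_self_of_ae_mem] at h1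
  exact mem_ae_iff.mpr hnull

/-- A nonnegative weight has its barycentre in the interval carrying the measure, which bounds
the integral of `z - x` against the weight from below. -/
lemma mul_integral_le_norm_integral_sub_mul {μ : Measure ℝ} {w : ℝ → ℝ} {a b d : ℝ} {z : ℂ}
    (hab : ∀ᵐ x ∂μ, x ∈ Set.Icc a b) (hw : ∀ x, 0 ≤ w x) (hwi : Integrable w μ)
    (hxwi : Integrable (fun x => x * w x) μ)
    (hd : ∀ x ∈ Set.Icc a b, d ≤ ‖z - (x : ℂ)‖) :
    d * ∫ x, w x ∂μ ≤ ‖∫ x, (z - (x : ℂ)) * (w x : ℂ) ∂μ‖ := by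
  have hW : 0 ≤ ∫ x, w x ∂μ := integral_nonneg hw
  have e : ∫ x, (z - (x : ℂ)) * (w x : ℂ) ∂μ
      = z * ((∫ x, w x ∂μ : ℝ) : ℂ) - ((∫ x, x * w x ∂μ : ℝ) : ℂ) := by
    rw [← integral_complex_ofReal, ← integral_complex_ofReal, ← integral_const_mul, ← integral_sub]
    · congr 1
      ext x
      push_cast
      ring
    · exact hwi.ofReal.const_mul z
    · exact hxwi.ofReal
  have h1 : a * ∫ x, w x ∂μ ≤ ∫ x, x * w x ∂μ := by
    rw [← integral_const_mul]
    refine integral_mono_ae (hwi.const_mul a) hxwi ?_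
    filter_upwards [hab] with x hx using mul_le_mul_of_nonneg_right hx.1 (hw x)
  have h2 : ∫ x, x * w x ∂μ ≤ b * ∫ x, w x ∂μ := by
    rw [← integral_const_mul]
    refine integral_mono_ae hxwi (hwi.const_mul b) ?_
    filter_upwards [hab] with x hx using mul_le_mul_of_nonneg_right hx.2 (hw x)
  rw [e]
  rcases hW.eq_or_lt with h0 | hpos
  · rw [← h0]
    simp
  · generalize (∫ x, w x ∂μ) = W at *
    generalize (∫ x, x * w x ∂μ) = M at *
    have hm : M / W ∈ Set.Icc a b := ⟨(le_div_iff₀ hpos).2 h1, (div_le_iff₀ hpos).2 h2⟩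
    have hWC : (W : ℂ) ≠ 0 := by exact_mod_cast hpos.ne'
    have e2 : z * (W : ℂ) - (M : ℂ) = (z - ((M / W : ℝ) : ℂ)) * (W : ℂ) := by
      push_cast
      field_simp
    rw [e2, norm_mul, Complex.norm_real, Real.norm_of_nonneg hW]
    exact mul_le_mul_of_nonneg_right (hd _ hm) hW

/-- The Christoffel–Darboux formula for two solutions of a three-term recurrence. -/
lemma christoffel_darboux {u v b c h : ℕ → ℂ} {z x : ℂ} (hh : ∀ n, h n ≠ 0)
    (hc : ∀ n, h (n + 1) = c (n + 1) * h n)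
    (hu0 : z * u 0 = u 1 + b 0 * u 0) (hv0 : x * v 0 = v 1 + b 0 * v 0)
    (hu : ∀ n, z * u (n + 1) = u (n + 2) + b (n + 1) * u (n + 1) + c (n + 1) * u n)
    (hv : ∀ n, x * v (n + 1) = v (n + 2) + b (n + 1) * v (n + 1) + c (n + 1) * v n) (n : ℕ) :
    (z - x) * ∑ k ∈ Finset.range (n + 1), u k / h k * v k
      = (u (n + 1) * v n - u n * v (n + 1)) / h n := by
  induction n with
  | zero =>
    have := hh 0
    simp only [zero_add, Finset.sum_range_one]
    field_simp
    linear_combination v 0 * hu0 - u 0 * hv0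
  | succ n ih =>
    rw [Finset.sum_range_succ, mul_add, ih]
    have h1 := hh n
    have h2 := hh (n + 1)
    have h3 : c (n + 1) ≠ 0 := by
      intro h0
      apply h2
      rw [hc, h0, zero_mul]
    rw [hc n]
    field_simp
    linear_combination v (n + 1) * hu n - u (n + 1) * hv n

/-- Orthogonality determines the recurrence coefficient and bounds it by the size of the
interval carrying the measure. -/
lemma integral_sq_succ_eq_and_le {μ : Measure ℝ} {p : ℕ → ℝ[X]} {b c : ℕ → ℝ} {R : ℝ}
    (hint : ∀ r : ℝ[X], Integrable (fun x => r.eval x) μ)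
    (hR : ∀ᵐ x ∂μ, |x| ≤ R)
    (horth : ∀ m n : ℕ, m ≠ n → ∫ x, (p m).eval x * (p n).eval x ∂μ = 0)
    (hrec0 : X * p 0 = p 1 + C (b 0) * p 0)
    (hrec : ∀ n, X * p (n + 1) = p (n + 2) + C (b (n + 1)) * p (n + 1) + C (c (n + 1)) * p n)
    (n : ℕ) :
    (∫ x, (p (n + 1)).eval x ^ 2 ∂μ = c (n + 1) * ∫ x, (p n).eval x ^ 2 ∂μ) ∧
      ∫ x, (p (n + 1)).eval x ^ 2 ∂μ ≤ R ^ 2 * ∫ x, (p n).eval x ^ 2 ∂μ := by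
  have hmul : ∀ m k, Integrable (fun x => (p m).eval x * (p k).eval x) μ := by
    intro m k
    exact (hint (p m * p k)).congr (.of_forall fun x => eval_mul)
  have hsq : ∀ m, Integrable (fun x => (p m).eval x ^ 2) μ := by
    intro m
    exact (hint (p m ^ 2)).congr (.of_forall fun x => eval_pow 2)
  have e1 : ∫ x, x * (p n).eval x * (p (n + 1)).eval x ∂μ
      = c (n + 1) * ∫ x, (p n).eval x ^ 2 ∂μ := by
    have : ∀ x, x * (p n).eval x * (p (n + 1)).eval x
        = (p (n + 2)).eval x * (p n).eval x + b (n + 1) * ((p (n + 1)).eval x * (p n).eval x)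
          + c (n + 1) * (p n).eval x ^ 2 := by
      intro x
      have := congrArg (eval x) (hrec n)
      simp only [eval_mul, eval_add, eval_X, eval_C] at this
      linear_combination (p n).eval x * this
    simp_rw [this]
    rw [integral_add ((hmul _ _).fun_add ((hmul _ _).const_mul _)) ((hsq _).const_mul _),
      integral_add (hmul _ _) ((hmul _ _).const_mul _), integral_const_mul, integral_const_mul,
      horth _ _ (by omega), horth _ _ (by omega)]
    ring
  have e2 : ∫ x, x * (p n).eval x * (p (n + 1)).eval x ∂μ
      = ∫ x, (p (n + 1)).eval x ^ 2 ∂μ := by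
    cases n with
    | zero =>
      have : ∀ x, x * (p 0).eval x * (p (0 + 1)).eval x
          = (p (0 + 1)).eval x ^ 2 + b 0 * ((p 0).eval x * (p 1).eval x) := by
        intro x
        have := congrArg (eval x) hrec0
        simp only [eval_mul, eval_add, eval_X, eval_C] at this
        linear_combination (p 1).eval x * this
      simp_rw [this]
      rw [integral_add (hsq _) ((hmul _ _).const_mul _), integral_const_mul,
        horth _ _ (by omega)]
      ring
    | succ n =>
      have : ∀ x, x * (p (n + 1)).eval x * (p (n + 1 + 1)).eval x
          = (p (n + 1 + 1)).eval x ^ 2 + b (n + 1) * ((p (n + 1)).eval x * (p (n + 2)).eval x)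
            + c (n + 1) * ((p n).eval x * (p (n + 2)).eval x) := by
        intro x
        have := congrArg (eval x) (hrec n)
        simp only [eval_mul, eval_add, eval_X, eval_C] at this
        linear_combination (p (n + 2)).eval x * this
      simp_rw [this]
      rw [integral_add ((hsq _).fun_add ((hmul _ _).const_mul _)) ((hmul _ _).const_mul _),
        integral_add (hsq _) ((hmul _ _).const_mul _), integral_const_mul, integral_const_mul,
        horth _ _ (by omega), horth _ _ (by omega)]
      ring
  refine ⟨e2.symm.trans e1, ?_⟩
  have h3 : ∫ x, x * (p n).eval x * (p (n + 1)).eval x ∂μ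
      ≤ ∫ x, (R ^ 2 / 2 * (p n).eval x ^ 2 + 1 / 2 * (p (n + 1)).eval x ^ 2) ∂μ := by
    refine integral_mono_ae ?_ (((hsq _).const_mul _).add ((hsq _).const_mul _)) ?_
    · exact (hint (X * p n * p (n + 1))).congr (.of_forall fun x => by simp)
    · filter_upwards [hR] with x hx
      have hx2 : x ^ 2 ≤ R ^ 2 := sq_le_sq.2 (hx.trans (le_abs_self R))
      nlinarith [sq_nonneg (x * (p n).eval x - (p (n + 1)).eval x),
        mul_le_mul_of_nonneg_right hx2 (sq_nonneg ((p n).eval x))]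
  rw [e2, integral_add ((hsq _).const_mul _) ((hsq _).const_mul _), integral_const_mul,
    integral_const_mul] at h3
  linarith

/-- Off the interval carrying the measure, the values of consecutive orthogonal polynomials
dominate the diagonal of the Christoffel–Darboux kernel. -/
lemma mul_sum_norm_sq_div_le {μ : Measure ℝ} {p : ℕ → ℝ[X]} {b c h : ℕ → ℝ} {a a' d : ℝ} {z : ℂ}
    (hint : ∀ f : ℝ → ℂ, Continuous f → Integrable f μ)
    (hab : ∀ᵐ x ∂μ, x ∈ Set.Icc a a')
    (hd : ∀ x ∈ Set.Icc a a', d ≤ ‖z - (x : ℂ)‖)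
    (horth : ∀ m n : ℕ, ∫ x, (p m).eval x * (p n).eval x ∂μ = if m = n then h m else 0)
    (hh : ∀ n, 0 < h n) (hc : ∀ n, h (n + 1) = c (n + 1) * h n)
    (hrec0 : X * p 0 = p 1 + C (b 0) * p 0)
    (hrec : ∀ n, X * p (n + 1) = p (n + 2) + C (b (n + 1)) * p (n + 1) + C (c (n + 1)) * p n)
    (n : ℕ) :
    d * ∑ k ∈ Finset.range (n + 1), ‖aeval z (p k)‖ ^ 2 / h k
      ≤ ‖aeval z (p (n + 1))‖ * ‖aeval z (p n)‖ / h n := by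
  have hhC : ∀ n, (h n : ℂ) ≠ 0 := fun n => by exact_mod_cast (hh n).ne'
  have hcont : ∀ k, Continuous fun x : ℝ => (((p k).eval x : ℝ) : ℂ) := fun k =>
    Complex.continuous_ofReal.comp (p k).continuous
  set u : ℕ → ℂ := fun k => aeval z (p k) with hu
  set g : ℝ → ℂ := fun x => ∑ k ∈ Finset.range (n + 1), u k / h k * ((p k).eval x : ℝ) with hg
  have hgc : Continuous g := by
    refine continuous_finsetSum _ fun k _ => ?_
    exact continuous_const.mul (hcont k)
  have hgs : Continuous fun x => (starRingEnd ℂ) (g x) := Complex.continuous_conj.comp hgc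
  have cd : ∀ x : ℝ, (z - x) * g x
      = (u (n + 1) * ((p n).eval x : ℝ) - u n * ((p (n + 1)).eval x : ℝ)) / h n := by
    intro x
    refine christoffel_darboux (u := u) (v := fun k => (((p k).eval x : ℝ) : ℂ))
      (b := fun k => (b k : ℂ)) (c := fun k => (c k : ℂ)) (h := fun k => (h k : ℂ)) hhC
      (fun n => by simp only [hc n]; push_cast; ring) ?_ ?_ ?_ ?_ n
    · simpa using congrArg (aeval z) hrec0
    · have := congrArg (eval x) hrec0
      simp only [eval_mul, eval_add, eval_X, eval_C] at this
      exact_mod_cast this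
    · intro n
      simpa using congrArg (aeval z) (hrec n)
    · intro n
      have := congrArg (eval x) (hrec n)
      simp only [eval_mul, eval_add, eval_X, eval_C] at this
      exact_mod_cast this
  have hpg : ∀ j, ∫ x, (((p j).eval x : ℝ) : ℂ) * (starRingEnd ℂ) (g x) ∂μ
      = if j < n + 1 then (starRingEnd ℂ) (u j) else 0 := by
    intro j
    have e : ∀ x, (((p j).eval x : ℝ) : ℂ) * (starRingEnd ℂ) (g x)
        = ∑ k ∈ Finset.range (n + 1),
          (starRingEnd ℂ) (u k) / h k * (((p j).eval x * (p k).eval x : ℝ) : ℂ) := by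
      intro x
      simp only [hg, map_sum, map_mul, map_div₀, Complex.conj_ofReal, Finset.mul_sum]
      refine Finset.sum_congr rfl fun k _ => ?_
      push_cast
      ring
    simp_rw [e]
    rw [integral_finsetSum]
    · simp_rw [integral_const_mul, integral_complex_ofReal, horth]
      have e3 : ∀ k, (starRingEnd ℂ) (u k) / (h k : ℂ) * ((if j = k then h j else 0 : ℝ) : ℂ)
          = if j = k then (starRingEnd ℂ) (u k) else 0 := by
        intro k
        split_ifs with hjk
        · subst hjk
          exact div_mul_cancel₀ _ (hhC j)
        · simp
      simp_rw [e3]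
      simp
    · intro k _
      refine (hint _ ?_).const_mul _
      exact Complex.continuous_ofReal.comp ((p j).continuous.mul (p k).continuous)
  have hpgi : ∀ j, Integrable (fun x => (((p j).eval x : ℝ) : ℂ) * (starRingEnd ℂ) (g x)) μ :=
    fun j => hint _ ((hcont j).mul hgs)
  have hnorm : ∀ x, ((‖g x‖ ^ 2 : ℝ) : ℂ) = g x * (starRingEnd ℂ) (g x) := by
    intro x
    rw [Complex.mul_conj, Complex.normSq_eq_norm_sq]
  have hW : ∫ x, ‖g x‖ ^ 2 ∂μ = ∑ k ∈ Finset.range (n + 1), ‖u k‖ ^ 2 / h k := by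
    have : ((∫ x, ‖g x‖ ^ 2 ∂μ : ℝ) : ℂ)
        = ((∑ k ∈ Finset.range (n + 1), ‖u k‖ ^ 2 / h k : ℝ) : ℂ) := by
      rw [← integral_complex_ofReal]
      have e : ∀ x, ((‖g x‖ ^ 2 : ℝ) : ℂ) = ∑ k ∈ Finset.range (n + 1),
          u k / h k * ((((p k).eval x : ℝ) : ℂ) * (starRingEnd ℂ) (g x)) := by
        intro x
        rw [hnorm]
        nth_rewrite 1 [hg]
        simp only [Finset.sum_mul]
        refine Finset.sum_congr rfl fun k _ => ?_
        ring
      refine (integral_congr_ae (Filter.Eventually.of_forall e)).trans ?_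
      rw [integral_finsetSum _ fun k _ => (hpgi k).const_mul _]
      push_cast
      refine Finset.sum_congr rfl fun k hk => ?_
      rw [integral_const_mul, hpg, if_pos (Finset.mem_range.1 hk), ← Complex.ofReal_pow,
        ← Complex.normSq_eq_norm_sq, ← Complex.mul_conj]
      ring
    exact_mod_cast this
  have hZ : ∫ x, (z - (x : ℂ)) * ((‖g x‖ ^ 2 : ℝ) : ℂ) ∂μ
      = u (n + 1) * (starRingEnd ℂ) (u n) / h n := by
    have e : ∀ x : ℝ, (z - (x : ℂ)) * ((‖g x‖ ^ 2 : ℝ) : ℂ)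
        = u (n + 1) / h n * ((((p n).eval x : ℝ) : ℂ) * (starRingEnd ℂ) (g x))
          - u n / h n * ((((p (n + 1)).eval x : ℝ) : ℂ) * (starRingEnd ℂ) (g x)) := by
      intro x
      rw [hnorm, ← mul_assoc, cd]
      ring
    refine (integral_congr_ae (Filter.Eventually.of_forall e)).trans ?_
    rw [integral_sub ((hpgi _).const_mul _) ((hpgi _).const_mul _), integral_const_mul,
      integral_const_mul, hpg, hpg, if_pos (by omega), if_neg (by omega)]
    ring
  have hwi : Integrable (fun x => ‖g x‖ ^ 2) μ := by
    have := (hint (fun x => ((‖g x‖ ^ 2 : ℝ) : ℂ)) (by fun_prop)).re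
    simpa only [RCLike.re_to_complex, Complex.ofReal_re] using this
  have hxwi : Integrable (fun x => x * ‖g x‖ ^ 2) μ := by
    have := (hint (fun x => ((x * ‖g x‖ ^ 2 : ℝ) : ℂ)) (by fun_prop)).re
    simpa only [RCLike.re_to_complex, Complex.ofReal_re] using this
  have key := mul_integral_le_norm_integral_sub_mul hab (fun x => sq_nonneg ‖g x‖) hwi hxwi hd
  rw [hW, hZ, norm_div, norm_mul, RCLike.norm_conj, Complex.norm_real,
    Real.norm_of_nonneg (hh n).le] at key
  exact key

/-- A sequence dominating a fixed multiple of its own partial sums and of bounded ratio of weights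
grows at least linearly. -/
lemma linear_growth_of_mul_sum_le {u h : ℕ → ℝ} {d R : ℝ} (hd : 0 < d) (hR : 0 < R)
    (hh : ∀ n, 0 < h n) (hhR : ∀ n, h (n + 1) ≤ R ^ 2 * h n) (hu0 : u 0 = 1)
    (key : ∀ n, d * ∑ k ∈ Finset.range (n + 1), u k ^ 2 / h k ≤ u (n + 1) * u n / h n) (n : ℕ) :
    n * ((d / R) ^ 4 / h 0) ≤ u (n + 1) ^ 2 / h (n + 1) := by
  have hnn : ∀ k, 0 ≤ u k ^ 2 / h k := fun k => div_nonneg (sq_nonneg _) (hh k).le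
  set S : ℕ → ℝ := fun n => ∑ k ∈ Finset.range (n + 1), u k ^ 2 / h k with hS
  have hSs : ∀ n, S (n + 1) = S n + u (n + 1) ^ 2 / h (n + 1) := fun n =>
    Finset.sum_range_succ _ _
  have hS0 : ∀ n, 1 / h 0 ≤ S n := by
    intro n
    have := Finset.single_le_sum (f := fun k => u k ^ 2 / h k) (fun k _ => hnn k)
      (Finset.mem_range.2 (Nat.succ_pos n))
    simpa [hu0] using this
  have hpos : ∀ n, 0 < S n := fun n => (one_div_pos.2 (hh 0)).trans_le (hS0 n)
  have hstep : ∀ n, (d / R) ^ 2 * S n ≤ u (n + 1) ^ 2 / h (n + 1) := by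
    intro n
    have h1 : u n ^ 2 / h n ≤ S n :=
      Finset.single_le_sum (f := fun k => u k ^ 2 / h k) (fun k _ => hnn k)
        (Finset.mem_range.2 (Nat.lt_succ_self n))
    have h2 : d * S n ≤ u (n + 1) * u n / h n := key n
    have h3 : (d * S n) ^ 2 ≤ (u (n + 1) * u n / h n) ^ 2 :=
      pow_le_pow_left₀ (mul_pos hd (hpos n)).le h2 2
    have h4 : (u (n + 1) * u n / h n) ^ 2 = u (n + 1) ^ 2 / h n * (u n ^ 2 / h n) := by
      field_simp
    have h5 : u (n + 1) ^ 2 / h n * (u n ^ 2 / h n) ≤ u (n + 1) ^ 2 / h n * S n :=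
      mul_le_mul_of_nonneg_left h1 (div_nonneg (sq_nonneg _) (hh n).le)
    have h6 : d ^ 2 * S n ≤ u (n + 1) ^ 2 / h n := by
      refine le_of_mul_le_mul_right ?_ (hpos n)
      nlinarith
    rw [le_div_iff₀ (hh n)] at h6
    rw [le_div_iff₀ (hh (n + 1)), div_pow]
    calc d ^ 2 / R ^ 2 * S n * h (n + 1) ≤ d ^ 2 / R ^ 2 * S n * (R ^ 2 * h n) :=
          mul_le_mul_of_nonneg_left (hhR n) (mul_nonneg (by positivity) (hpos n).le)
      _ = d ^ 2 * S n * h n := by field_simp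
      _ ≤ u (n + 1) ^ 2 := h6
  have hlin : ∀ n : ℕ, n * ((d / R) ^ 2 / h 0) ≤ S n := by
    intro n
    induction n with
    | zero => simpa using (hpos 0).le
    | succ n ih =>
      rw [hSs]
      have h1 := mul_le_mul_of_nonneg_left (hS0 n) (sq_nonneg (d / R))
      rw [mul_one_div] at h1
      push_cast
      linarith [hstep n]
  have h1 := mul_le_mul_of_nonneg_left (hlin n) (sq_nonneg (d / R))
  refine le_trans (le_of_eq ?_) (h1.trans (hstep n))
  ring

/-- The functions of the second kind connect the orthogonal polynomials with their first
associated polynomials. -/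
lemma aeval_mul_integral_sub_integral_eq {μ : Measure ℝ} {p q : ℕ → ℝ[X]} {b c : ℕ → ℝ} {z : ℂ}
    (hint : ∀ r : ℝ[X], Integrable (fun x : ℝ => ((r.eval x : ℝ) : ℂ)) μ)
    (hintz : ∀ r : ℝ[X], Integrable (fun x : ℝ => ((r.eval x : ℝ) : ℂ) * (z - (x : ℂ))⁻¹) μ)
    (hz : ∀ᵐ x : ℝ ∂μ, z - (x : ℂ) ≠ 0) (hp0 : p 0 = 1)
    (hmean : ∀ n, ∫ x, (p (n + 1)).eval x ∂μ = 0)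
    (hrec0 : X * p 0 = p 1 + C (b 0) * p 0)
    (hrec : ∀ n, X * p (n + 1) = p (n + 2) + C (b (n + 1)) * p (n + 1) + C (c (n + 1)) * p n)
    (hq0 : q 0 = 1) (hq1 : q 1 = X - C (b 1))
    (hqrec : ∀ n, X * q (n + 1)
      = q (n + 2) + C (b (n + 2)) * q (n + 1) + C (c (n + 2)) * q n) (n : ℕ) :
    aeval z (p (n + 1)) * (∫ x : ℝ, (z - (x : ℂ))⁻¹ ∂μ)
        - ∫ x : ℝ, (((p (n + 1)).eval x : ℝ) : ℂ) * (z - (x : ℂ))⁻¹ ∂μ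
      = ((μ.real Set.univ : ℝ) : ℂ) * aeval z (q n) := by
  set G : ℕ → ℂ := fun n => ∫ x : ℝ, (((p n).eval x : ℝ) : ℂ) * (z - (x : ℂ))⁻¹ ∂μ with hG
  have hG0 : ∫ x : ℝ, (z - (x : ℂ))⁻¹ ∂μ = G 0 := by simp [hG, hp0]
  have hmulX : ∀ r : ℝ[X],
      ∫ x : ℝ, (((X * r).eval x : ℝ) : ℂ) * (z - (x : ℂ))⁻¹ ∂μ
        = z * (∫ x : ℝ, ((r.eval x : ℝ) : ℂ) * (z - (x : ℂ))⁻¹ ∂μ)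
          - ((∫ x, r.eval x ∂μ : ℝ) : ℂ) := by
    intro r
    rw [← integral_complex_ofReal, ← integral_const_mul, ← integral_sub ((hintz r).const_mul z) (hint r)]
    refine integral_congr_ae ?_
    filter_upwards [hz] with x hx
    simp only [eval_mul, eval_X]
    push_cast
    field_simp
    ring
  have hG1 : z * G 0 = G 1 + b 0 * G 0 + ((μ.real Set.univ : ℝ) : ℂ) := by
    have h1 := hmulX (p 0)
    rw [hrec0] at h1
    have h2 : ∫ x : ℝ, (((p 1 + C (b 0) * p 0).eval x : ℝ) : ℂ) * (z - (x : ℂ))⁻¹ ∂μ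
        = G 1 + b 0 * G 0 := by
      rw [hG, ← integral_const_mul, ← integral_add (hintz _) ((hintz _).const_mul _)]
      congr 1
      ext x
      simp only [eval_add, eval_mul, eval_C]
      push_cast
      ring
    have h3 : ∫ x, (p 0).eval x ∂μ = μ.real Set.univ := by simp [hp0]
    rw [h2, h3] at h1
    linear_combination -h1
  have hGs : ∀ n, z * G (n + 1) = G (n + 2) + b (n + 1) * G (n + 1) + c (n + 1) * G n := by
    intro n
    have h1 := hmulX (p (n + 1))
    rw [hrec n] at h1
    have h2 : ∫ x : ℝ, (((p (n + 2) + C (b (n + 1)) * p (n + 1) + C (c (n + 1)) * p n).eval x : ℝ)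
          : ℂ) * (z - (x : ℂ))⁻¹ ∂μ = G (n + 2) + b (n + 1) * G (n + 1) + c (n + 1) * G n := by
      rw [hG, ← integral_const_mul, ← integral_const_mul,
        ← integral_add (hintz _) ((hintz _).const_mul _),
        ← integral_add ((hintz _).fun_add ((hintz _).const_mul _)) ((hintz _).const_mul _)]
      congr 1
      ext x
      simp only [eval_add, eval_mul, eval_C]
      push_cast
      ring
    rw [h2, hmean n] at h1
    push_cast at h1
    linear_combination -h1
  have hu0 : aeval z (p 0) = (1 : ℂ) := by simp [hp0]
  have hu1 : z * aeval z (p 0) = aeval z (p 1) + b 0 * aeval z (p 0) := by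
    simpa using congrArg (aeval z) hrec0
  have hus : ∀ n, z * aeval z (p (n + 1)) = aeval z (p (n + 2)) + b (n + 1) * aeval z (p (n + 1))
      + c (n + 1) * aeval z (p n) := by
    intro n
    simpa using congrArg (aeval z) (hrec n)
  have hqs : ∀ n, z * aeval z (q (n + 1)) = aeval z (q (n + 2)) + b (n + 2) * aeval z (q (n + 1))
      + c (n + 2) * aeval z (q n) := by
    intro n
    simpa using congrArg (aeval z) (hqrec n)
  have hv0 : aeval z (q 0) = (1 : ℂ) := by simp [hq0]
  have hv1 : aeval z (q 1) = z - b 1 := by simp [hq1]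
  rw [hG0]
  change aeval z (p (n + 1)) * G 0 - G (n + 1) = _
  have base : aeval z (p 1) * G 0 - G 1 = ((μ.real Set.univ : ℝ) : ℂ) * aeval z (q 0) := by
    rw [hv0]
    rw [hu0] at hu1
    linear_combination hG1 - G 0 * hu1
  induction n using Nat.twoStepInduction with
  | zero => exact base
  | one =>
    rw [hv0] at base
    have h1 := hus 0
    have h2 := hGs 0
    simp only [zero_add] at h1 h2
    rw [hu0] at h1
    simp only [Nat.reduceAdd]
    rw [hv1]
    linear_combination h2 - G 0 * h1 + (z - b 1) * base
  | more n ih1 ih2 =>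
    linear_combination hGs (n + 1) - G 0 * hus (n + 1) + (z - b (n + 2)) * ih2
      - c (n + 2) * ih1 + ((μ.real Set.univ : ℝ) : ℂ) * hqs n

/-- The function of the second kind is bounded by the `L²` norm of the polynomial. -/
lemma norm_integral_mul_inv_le {μ : Measure ℝ} [IsFiniteMeasure μ] {f : ℝ → ℝ} {z : ℂ} {d : ℝ}
    (hd : 0 < d) (hz : ∀ᵐ x : ℝ ∂μ, d ≤ ‖z - (x : ℂ)‖) (hf : Integrable (fun x => f x ^ 2) μ)
    (hpos : 0 < ∫ x, f x ^ 2 ∂μ) :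
    ‖∫ x : ℝ, (f x : ℂ) * (z - (x : ℂ))⁻¹ ∂μ‖
      ≤ (1 + μ.real Set.univ) / (2 * d) * √(∫ x, f x ^ 2 ∂μ) := by
  set s := √(∫ x, f x ^ 2 ∂μ) with hs
  have hs0 : 0 < s := Real.sqrt_pos.2 hpos
  have hs2 : ∫ x, f x ^ 2 ∂μ = s ^ 2 := (Real.sq_sqrt hpos.le).symm
  have h1 : ‖∫ x : ℝ, (f x : ℂ) * (z - (x : ℂ))⁻¹ ∂μ‖
      ≤ ∫ x, (1 / (2 * d * s) * f x ^ 2 + s / (2 * d)) ∂μ := by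
    refine norm_integral_le_of_norm_le ((hf.const_mul _).add (integrable_const _)) ?_
    filter_upwards [hz] with x hx
    rw [norm_mul, norm_inv, Complex.norm_real, Real.norm_eq_abs]
    have h2 : ‖z - (x : ℂ)‖⁻¹ ≤ d⁻¹ := inv_anti₀ hd hx
    refine (mul_le_mul_of_nonneg_left h2 (abs_nonneg _)).trans ?_
    have h3 : 1 / (2 * d * s) * f x ^ 2 + s / (2 * d) - |f x| * d⁻¹
        = (|f x| - s) ^ 2 / (2 * d * s) := by
      rw [← sq_abs (f x)]
      field_simp
      ring
    have h4 : 0 ≤ (|f x| - s) ^ 2 / (2 * d * s) := by positivity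
    linarith
  rw [integral_add (hf.const_mul _) (integrable_const _), integral_const_mul, hs2,
    integral_const, smul_eq_mul] at h1
  refine h1.trans (le_of_eq ?_)
  field_simp

/-- **Markov's theorem.** Let `μ` be a positive measure on `ℝ` with infinite compact
support, `(pₙ)` its monic orthogonal polynomials with recurrence coefficients
`bₙ, cₙ`, and `(pₙ⁽¹⁾)` the first associated polynomials. If `I` is the smallest
closed interval containing the support of `μ`, then `pₙ₋₁⁽¹⁾(z)/pₙ(z)` converges to
`(1/μ₀) ∫ dμ(x)/(z−x)` uniformly on compact subsets of `ℂ ∖ I`. -/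
theorem markov_theorem
    (μ : Measure ℝ) [IsFiniteMeasure μ]
    (hsupp_inf : (measureSupport μ).Infinite)
    (hsupp_cpt : IsCompact (measureSupport μ))
    (hnull : μ (measureSupport μ)ᶜ = 0)
    (hmom : ∀ n : ℕ, Integrable (fun x : ℝ => |x| ^ n) μ)
    (p : ℕ → Polynomial ℝ)
    (hmonic : ∀ n : ℕ, (p n).Monic)
    (hdeg : ∀ n : ℕ, (p n).natDegree = n)
    (horth : ∀ m n : ℕ, m ≠ n → ∫ x, (p m).eval x * (p n).eval x ∂μ = 0)
    (b c : ℕ → ℝ) (hc_pos : ∀ n : ℕ, 1 ≤ n → 0 < c n)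
    (hrec0 : ∀ x : ℝ, x * (p 0).eval x = (p 1).eval x + b 0 * (p 0).eval x)
    (hrec : ∀ n : ℕ, 1 ≤ n → ∀ x : ℝ,
      x * (p n).eval x =
        (p (n + 1)).eval x + b n * (p n).eval x + c n * (p (n - 1)).eval x)
    (q : ℕ → Polynomial ℝ)
    (hq0 : q 0 = 1) (hq1 : q 1 = X - C (b 1))
    (hqrec : ∀ n : ℕ, 1 ≤ n → ∀ x : ℝ,
      x * (q n).eval x =
        (q (n + 1)).eval x + b (n + 1) * (q n).eval x + c (n + 1) * (q (n - 1)).eval x)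
    (I : Set ℝ)
    (hI : I = Set.Icc (sInf (measureSupport μ)) (sSup (measureSupport μ))) :
    ∀ K : Set ℂ, IsCompact K → (∀ z ∈ K, ∀ x ∈ I, (x : ℂ) ≠ z) →
      TendstoUniformlyOn
        (fun (n : ℕ) (z : ℂ) =>
          Polynomial.aeval z (q n) / Polynomial.aeval z (p (n + 1)))
        (fun z : ℂ =>
          (((μ Set.univ).toReal)⁻¹ : ℂ) * ∫ x : ℝ, (z - (x : ℂ))⁻¹ ∂μ)
        Filter.atTop K := by
  intro K hK hKI
  set S := measureSupport μ with hS
  have hSne : S.Nonempty := hsupp_inf.nonempty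
  have hmem : ∀ᵐ x ∂μ, x ∈ S := mem_ae_iff.mpr hnull
  have hSI : S ⊆ I := by
    rw [hI]
    exact fun x hx => ⟨csInf_le hsupp_cpt.bddBelow hx, le_csSup hsupp_cpt.bddAbove hx⟩
  have hIae : ∀ᵐ x ∂μ, x ∈ I := hmem.mono fun x hx => hSI hx
  have hμ0 : 0 < μ.real Set.univ := by
    obtain ⟨x, hx⟩ := hSne
    exact ENNReal.toReal_pos (hx _ Filter.univ_mem).ne' (measure_ne_top _ _)
  have hIcpt : IsCompact I := hI ▸ isCompact_Icc
  obtain ⟨d, hd, hdK⟩ : ∃ d : ℝ, 0 < d ∧ ∀ z ∈ K, ∀ x ∈ I, d ≤ ‖z - (x : ℂ)‖ := by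
    have hdisj : Disjoint K ((fun x : ℝ => (x : ℂ)) '' I) := by
      rw [Set.disjoint_left]
      rintro z hz ⟨x, hx, rfl⟩
      exact hKI _ hz x hx rfl
    obtain ⟨r, hr, hrK⟩ := Metric.exists_pos_forall_lt_edist hK
      (hIcpt.image Complex.continuous_ofReal).isClosed hdisj
    refine ⟨r, hr, fun z hz x hx => ?_⟩
    have := hrK z hz _ ⟨x, hx, rfl⟩
    rw [edist_nndist, ENNReal.coe_lt_coe] at this
    rw [← dist_eq_norm, ← coe_nndist]
    exact_mod_cast this.le
  obtain ⟨R, hR, hRI⟩ : ∃ R : ℝ, 0 < R ∧ ∀ x ∈ I, |x| ≤ R := by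
    obtain ⟨R, hR, hRI⟩ := hIcpt.isBounded.exists_pos_norm_le
    exact ⟨R, hR, hRI⟩
  have hint : ∀ f : ℝ → ℂ, Continuous f → Integrable f μ := fun f hf =>
    integrable_of_continuousOn_of_null_compl hsupp_cpt hnull hf.continuousOn
  have hintC : ∀ r : ℝ[X], Integrable (fun x : ℝ => ((r.eval x : ℝ) : ℂ)) μ := fun r =>
    hint _ (Complex.continuous_ofReal.comp r.continuous)
  have hintR : ∀ r : ℝ[X], Integrable (fun x : ℝ => r.eval x) μ := by
    intro r
    simpa only [RCLike.re_to_complex, Complex.ofReal_re] using (hintC r).re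
  have hp0 : p 0 = 1 := Polynomial.eq_one_of_monic_natDegree_zero (hmonic 0) (hdeg 0)
  have hprec0 : X * p 0 = p 1 + C (b 0) * p 0 :=
    Polynomial.funext fun x => by simpa using hrec0 x
  have hprec : ∀ n, X * p (n + 1)
      = p (n + 2) + C (b (n + 1)) * p (n + 1) + C (c (n + 1)) * p n := fun n =>
    Polynomial.funext fun x => by simpa using hrec (n + 1) (by omega) x
  have hqrec' : ∀ n, X * q (n + 1)
      = q (n + 2) + C (b (n + 2)) * q (n + 1) + C (c (n + 2)) * q n := fun n =>
    Polynomial.funext fun x => by simpa using hqrec (n + 1) (by omega) x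
  have hh := integral_sq_succ_eq_and_le hintR (hIae.mono hRI) horth hprec0 hprec
  set h : ℕ → ℝ := fun n => ∫ x, (p n).eval x ^ 2 ∂μ with hdef
  have hh0 : h 0 = μ.real Set.univ := by simp [hdef, hp0]
  have hhpos : ∀ n, 0 < h n := by
    intro n
    induction n with
    | zero => rwa [hh0]
    | succ n ih =>
      have : h (n + 1) = c (n + 1) * h n := (hh n).1
      rw [this]
      exact mul_pos (hc_pos _ (by omega)) ih
  have horth' : ∀ m n : ℕ,
      ∫ x, (p m).eval x * (p n).eval x ∂μ = if m = n then h m else 0 := by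
    intro m n
    split_ifs with hmn
    · subst hmn
      simp only [hdef, sq]
    · exact horth m n hmn
  have hmean : ∀ n, ∫ x, (p (n + 1)).eval x ∂μ = 0 := by
    intro n
    simpa [hp0] using horth (n + 1) 0 (by omega)
  set B : ℝ := (1 + μ.real Set.univ) / (2 * d) / μ.real Set.univ with hB
  have hB0 : 0 ≤ B := by positivity
  set κ : ℝ := (d / R) ^ 4 / h 0 with hκ
  have hκ0 : 0 < κ := div_pos (by positivity) (hhpos 0)
  have hbound : ∀ n : ℕ, 0 < n → ∀ z ∈ K,
      dist ((((μ Set.univ).toReal)⁻¹ : ℂ) * ∫ x : ℝ, (z - (x : ℂ))⁻¹ ∂μ)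
        (aeval z (q n) / aeval z (p (n + 1))) ≤ B / √(n * κ) := by
    intro n hn z hz
    have hdz := hdK z hz
    have hdae : ∀ᵐ x : ℝ ∂μ, d ≤ ‖z - (x : ℂ)‖ := hIae.mono hdz
    have hgrow := linear_growth_of_mul_sum_le (u := fun k => ‖aeval z (p k)‖) (h := h) hd hR hhpos
      (fun n => (hh n).2) (by simp [hp0])
      (mul_sum_norm_sq_div_le hint (hI ▸ hIae) (hI ▸ hdz) horth' hhpos (fun n => (hh n).1)
        hprec0 hprec) n
    have hintz : ∀ r : ℝ[X],
        Integrable (fun x : ℝ => ((r.eval x : ℝ) : ℂ) * (z - (x : ℂ))⁻¹) μ := by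
      intro r
      refine integrable_of_continuousOn_of_null_compl hsupp_cpt hnull ?_
      refine (Complex.continuous_ofReal.comp r.continuous).continuousOn.mul
        (ContinuousOn.inv₀ (by fun_prop) fun x hx => ?_)
      exact norm_pos_iff.1 (hd.trans_le (hdz x (hSI hx)))
    have hsecond := aeval_mul_integral_sub_integral_eq hintC hintz
      (hdae.mono fun x hx => norm_pos_iff.1 (hd.trans_le hx)) hp0 hmean hprec0 hprec hq0 hq1
      hqrec' n
    have hGle := norm_integral_mul_inv_le (f := fun x => (p (n + 1)).eval x) hd hdae
      ((hintR (p (n + 1) ^ 2)).congr (.of_forall fun x => eval_pow 2)) (hhpos (n + 1))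
    change _ ≤ _ * √(h (n + 1)) at hGle
    have hnκ : 0 < n * κ := mul_pos (by exact_mod_cast hn) hκ0
    have hgrow' : n * κ * h (n + 1) ≤ ‖aeval z (p (n + 1))‖ ^ 2 :=
      (le_div_iff₀ (hhpos _)).1 hgrow
    have hsqrt : √(n * κ) * √(h (n + 1)) ≤ ‖aeval z (p (n + 1))‖ := by
      rw [← Real.sqrt_mul hnκ.le]
      exact Real.sqrt_le_iff.2 ⟨norm_nonneg _, hgrow'⟩
    have hs1 : 0 < √(n * κ) := Real.sqrt_pos.2 hnκ
    have hs2 : 0 < √(h (n + 1)) := Real.sqrt_pos.2 (hhpos _)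
    have hunorm : 0 < ‖aeval z (p (n + 1))‖ := (mul_pos hs1 hs2).trans_le hsqrt
    have hune : aeval z (p (n + 1)) ≠ 0 := norm_pos_iff.1 hunorm
    have hμC : ((μ.real Set.univ : ℝ) : ℂ) ≠ 0 := by exact_mod_cast hμ0.ne'
    have herr : (((μ Set.univ).toReal)⁻¹ : ℂ) * (∫ x : ℝ, (z - (x : ℂ))⁻¹ ∂μ)
        - aeval z (q n) / aeval z (p (n + 1))
        = (∫ x : ℝ, (((p (n + 1)).eval x : ℝ) : ℂ) * (z - (x : ℂ))⁻¹ ∂μ)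
          / (((μ.real Set.univ : ℝ) : ℂ) * aeval z (p (n + 1))) := by
      change (((μ.real Set.univ : ℝ) : ℂ))⁻¹ * _ - _ = _
      rw [inv_mul_eq_div, div_sub_div _ _ hμC hune, ← hsecond]
      ring
    rw [dist_eq_norm, herr, norm_div, norm_mul, Complex.norm_real, Real.norm_of_nonneg hμ0.le,
      div_le_div_iff₀ (mul_pos hμ0 hunorm) hs1]
    calc _ ≤ (1 + μ.real Set.univ) / (2 * d) * √(h (n + 1)) * √(n * κ) :=
          mul_le_mul_of_nonneg_right hGle hs1.le
      _ = B * (μ.real Set.univ * (√(n * κ) * √(h (n + 1)))) := by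
          rw [hB]
          field_simp
      _ ≤ B * (μ.real Set.univ * ‖aeval z (p (n + 1))‖) := by gcongr
  have hlim : Filter.Tendsto (fun n : ℕ => B / √(n * κ)) Filter.atTop (nhds 0) :=
    (Real.tendsto_sqrt_atTop.comp
      (tendsto_natCast_atTop_atTop.atTop_mul_const hκ0)).const_div_atTop B
  rw [Metric.tendstoUniformlyOn_iff]
  intro ε hε
  filter_upwards [hlim.eventually_lt_const hε, Filter.eventually_gt_atTop 0] with n hn hn0 z hz
  exact (hbound n hn0 z hz).trans_lt hn
end
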